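/- arXiv:2501.16876 — 11 statements merged into one kernel-verified Lean document; each statement's English description precedes it below -/
import Mathlib

section
/- For any matrices A, B ∈ ℂ^{n×n} there exist unitary matrices Q, Z ∈ ℂ^{n×n} such that both QAZ and QBZ are upper triangular matrices. -/
open Matrix in
/-- Two square complex matrices of positive size map some nonzero vector into a common line. -/
theorem exists_ne_zero_mulVec_eq_smul_common {n : ℕ} (A B : Matrix (Fin (n + 1)) (Fin (n + 1)) ℂ) :
    ∃ z q : Fin (n + 1) → ℂ, z ≠ 0 ∧ ∃ a b : ℂ, A *ᵥ z = a • q ∧ B *ᵥ z = b • q := by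
  by_cases hA : A.det = 0
  · obtain ⟨z, hz, hAz⟩ := Matrix.exists_mulVec_eq_zero_iff.mpr hA
    exact ⟨z, B *ᵥ z, hz, 0, 1, by simp [hAz], by simp⟩
  · obtain ⟨μ, hμ⟩ := Module.End.exists_eigenvalue (Matrix.toLin' (A⁻¹ * B))
    obtain ⟨z, hz⟩ := hμ.exists_hasEigenvector
    refine ⟨z, A *ᵥ z, hz.2, 1, μ, by simp, ?_⟩
    have h : (A⁻¹ * B) *ᵥ z = μ • z := by simpa using hz.apply_eq_smul
    rw [← Matrix.mulVec_smul, ← h, Matrix.mulVec_mulVec,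
      Matrix.mul_nonsing_inv_cancel_left _ _ (isUnit_iff_ne_zero.mpr hA)]

/-- Every complex vector is a multiple of the first column of some unitary matrix. -/
theorem exists_unitary_col_zero {n : ℕ} (v : Fin (n + 1) → ℂ) :
    ∃ U ∈ Matrix.unitaryGroup (Fin (n + 1)) ℂ, ∃ c : ℂ, v = c • U.col 0 := by
  by_cases hv : v = 0
  · exact ⟨1, one_mem _, 0, by simp [hv]⟩
  set w : EuclideanSpace ℂ (Fin (n + 1)) := WithLp.toLp 2 v with hw
  have hw0 : w ≠ 0 := by simpa [hw] using hv
  have hn : (‖w‖ : ℂ) ≠ 0 := by simpa using hw0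
  have ho : Orthonormal ℂ (({0} : Set (Fin (n + 1))).domRestrict
      fun _ => ((‖w‖ : ℂ)⁻¹ • w : EuclideanSpace ℂ (Fin (n + 1)))) := by
    refine ⟨fun _ => ?_, fun i j hij => (hij (Subsingleton.elim i j)).elim⟩
    exact norm_smul_inv_norm (𝕜 := ℂ) hw0
  obtain ⟨b, hb⟩ := ho.exists_orthonormalBasis_extension_of_card_eq (by simp)
  refine ⟨Matrix.of fun i j => b j i, ?_, ‖w‖, ?_⟩
  · rw [Matrix.mem_unitaryGroup_iff']
    ext i j
    have h := orthonormal_iff_ite.mp b.orthonormal i j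
    rw [PiLp.inner_apply] at h
    simpa [Matrix.mul_apply, Matrix.star_apply, Matrix.one_apply, mul_comm] using h
  · ext i
    simp [hb 0 rfl, hw, mul_inv_cancel_left₀ (hw ▸ hn)]

/-- The block diagonal matrix `diag(1, M)`. -/
def Matrix.oneBorder {n : ℕ} (M : Matrix (Fin n) (Fin n) ℂ) :
    Matrix (Fin (n + 1)) (Fin (n + 1)) ℂ :=
  Matrix.of (Fin.cons (Fin.cons 1 0) fun i => Fin.cons 0 (M i))

theorem Matrix.oneBorder_mem_unitaryGroup {n : ℕ} {M : Matrix (Fin n) (Fin n) ℂ}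
    (hM : M ∈ Matrix.unitaryGroup (Fin n) ℂ) :
    M.oneBorder ∈ Matrix.unitaryGroup (Fin (n + 1)) ℂ := by
  rw [Matrix.mem_unitaryGroup_iff] at hM ⊢
  ext i j
  refine Fin.cases ?_ (fun i => ?_) i <;> refine Fin.cases ?_ (fun j => ?_) j
  · simp [oneBorder, mul_apply, Fin.sum_univ_succ]
  · simp [oneBorder, mul_apply, Fin.sum_univ_succ, (Fin.succ_ne_zero _).symm]
  · simp [oneBorder, mul_apply, Fin.sum_univ_succ]
  · have h := congrFun (congrFun hM i) j
    simpa [oneBorder, mul_apply, Fin.sum_univ_succ, one_apply] using h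

/-- If the first column of `M` vanishes below the diagonal and `Q`, `Z` triangularize the
trailing principal submatrix, then the bordered matrices triangularize `M`. -/
theorem Matrix.oneBorder_mul_mul_oneBorder_apply_eq_zero {n : ℕ}
    {M : Matrix (Fin (n + 1)) (Fin (n + 1)) ℂ} {Q Z : Matrix (Fin n) (Fin n) ℂ}
    (hM : ∀ i : Fin n, M i.succ 0 = 0)
    (h : ∀ i j : Fin n, j < i → (Q * M.submatrix Fin.succ Fin.succ * Z) i j = 0)
    (i j : Fin (n + 1)) (hij : j < i) : (Q.oneBorder * M * Z.oneBorder) i j = 0 := by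
  induction i using Fin.cases with
  | zero => exact absurd hij (Fin.not_lt_zero j)
  | succ i =>
    induction j using Fin.cases with
    | zero => simp [oneBorder, mul_apply, Fin.sum_univ_succ, hM]
    | succ j =>
      have h := h i j (Fin.succ_lt_succ_iff.mp hij)
      simpa [oneBorder, mul_apply, Fin.sum_univ_succ, hM] using h

open Matrix in
/-- If `A` maps the first column of `Z` into the line spanned by the first column of the unitary
matrix `W`, then the first column of `Wᴴ A Z` vanishes below the diagonal. -/
theorem Matrix.star_mul_mul_apply_succ_zero {n : ℕ} {A W Z : Matrix (Fin (n + 1)) (Fin (n + 1)) ℂ}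
    (hW : W ∈ Matrix.unitaryGroup (Fin (n + 1)) ℂ) {c : ℂ}
    (h : A *ᵥ Z.col 0 = c • W.col 0) (i : Fin n) : (star W * A * Z) i.succ 0 = 0 := by
  have h1 : (star W * A * Z).col 0 = c • (star W * W).col 0 := by
    rw [← mulVec_single_one, ← mulVec_single_one, ← mulVec_mulVec, ← mulVec_mulVec,
      ← mulVec_mulVec, mulVec_single_one, mulVec_single_one, h, mulVec_smul]
  rw [Matrix.mem_unitaryGroup_iff'.mp hW] at h1
  simpa [one_apply] using congrFun h1 i.succ

/-- Generalized Schur form (Stewart): for any matrices `A, B ∈ ℂ^{n×n}`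
there exist unitary `Q, Z` such that `QAZ` and `QBZ` are both upper triangular. -/
theorem generalized_schur_form (n : ℕ) (A B : Matrix (Fin n) (Fin n) ℂ) :
    ∃ Q Z : Matrix (Fin n) (Fin n) ℂ,
      Q ∈ Matrix.unitaryGroup (Fin n) ℂ ∧ Z ∈ Matrix.unitaryGroup (Fin n) ℂ ∧
      (∀ i j : Fin n, j < i → (Q * A * Z) i j = 0) ∧
      (∀ i j : Fin n, j < i → (Q * B * Z) i j = 0) := by
  induction n with
  | zero => exact ⟨1, 1, one_mem _, one_mem _, fun i => i.elim0, fun i => i.elim0⟩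
  | succ n ih =>
    obtain ⟨z, q, hz, a, b, hA, hB⟩ := exists_ne_zero_mulVec_eq_smul_common A B
    obtain ⟨U, hU, c, rfl⟩ := exists_unitary_col_zero z
    obtain ⟨W, hW, d, rfl⟩ := exists_unitary_col_zero q
    have hc : c ≠ 0 := fun h => hz (by simp [h])
    rw [Matrix.mulVec_smul, smul_smul, ← eq_inv_smul_iff₀ hc, smul_smul] at hA hB
    obtain ⟨Q, Z, hQ, hZ, hQA, hQB⟩ := ih ((star W * A * U).submatrix Fin.succ Fin.succ)
      ((star W * B * U).submatrix Fin.succ Fin.succ)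
    refine ⟨Q.oneBorder * star W, U * Z.oneBorder,
      mul_mem (Matrix.oneBorder_mem_unitaryGroup hQ) (Unitary.star_mem hW),
      mul_mem hU (Matrix.oneBorder_mem_unitaryGroup hZ), fun i j hij => ?_, fun i j hij => ?_⟩
    · simpa only [Matrix.mul_assoc] using Matrix.oneBorder_mul_mul_oneBorder_apply_eq_zero
        (Matrix.star_mul_mul_apply_succ_zero hW hA) hQA i j hij
    · simpa only [Matrix.mul_assoc] using Matrix.oneBorder_mul_mul_oneBorder_apply_eq_zero
        (Matrix.star_mul_mul_apply_succ_zero hW hB) hQB i j hij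
end

section
/- Let Ω be a nonempty closed subset of the Riemann sphere ℂ ∪ {∞}, let (A,B) be an n×n pencil, and let p_Ω and T be as in the context. Then T(A,B) belongs to the closure of S_tri(Ω,n), and for every pencil (S,T') in the closure of S_tri(Ω,n) one has ‖(A,B) − T(A,B)‖ ≤ ‖(A,B) − (S,T')‖; that is, T(A,B) is a nearest point to (A,B) in the closure of S_tri(Ω,n). -/
open Matrix

/-- The determinant `det(A + X·B)` of the pencil `P = (A,B)`, as a polynomial in `X`. -/
noncomputable def pencilPoly {n : ℕ}
    (P : Matrix (Fin n) (Fin n) ℂ × Matrix (Fin n) (Fin n) ℂ) : Polynomial ℂ :=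
  (P.1.map Polynomial.C + (Polynomial.X : Polynomial ℂ) • P.2.map Polynomial.C).det

/-- `S(Ω,n)`: the set of regular `n×n` pencils all of whose eigenvalues (finite eigenvalues
are the roots of `det(A + X·B)`; `∞` is an eigenvalue iff `det B = 0`) belong to `Ω`,
a subset of the Riemann sphere `ℂ ∪ {∞}`. -/
def SOmega (Ω : Set (OnePoint ℂ)) (n : ℕ) :
    Set (Matrix (Fin n) (Fin n) ℂ × Matrix (Fin n) (Fin n) ℂ) :=
  {P | pencilPoly P ≠ 0 ∧
    (∀ z : ℂ, (pencilPoly P).IsRoot z → (z : OnePoint ℂ) ∈ Ω) ∧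
    (P.2.det = 0 → (OnePoint.infty : OnePoint ℂ) ∈ Ω)}

/-- `S_tri(Ω,n)`: the pencils of `S(Ω,n)` with both coefficients upper triangular. -/
def Stri (Ω : Set (OnePoint ℂ)) (n : ℕ) :
    Set (Matrix (Fin n) (Fin n) ℂ × Matrix (Fin n) (Fin n) ℂ) :=
  {P ∈ SOmega Ω n |
    (∀ i j : Fin n, j < i → P.1 i j = 0) ∧ (∀ i j : Fin n, j < i → P.2 i j = 0)}

/-- `S(Ω,1)` for `1×1` pencils, identified with pairs `(a,b) ∈ ℂ²`. -/
def SOmega1 (Ω : Set (OnePoint ℂ)) : Set (ℂ × ℂ) :=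
  {p | p ≠ (0, 0) ∧ (p.2 ≠ 0 → ((-p.1 / p.2 : ℂ) : OnePoint ℂ) ∈ Ω) ∧
    (p.2 = 0 → (OnePoint.infty : OnePoint ℂ) ∈ Ω)}

/-- The norm `‖(A,B)‖ = (‖A‖_F² + ‖B‖_F²)^{1/2}` of a pencil. -/
noncomputable def pencilNorm {n : ℕ}
    (P : Matrix (Fin n) (Fin n) ℂ × Matrix (Fin n) (Fin n) ℂ) : ℝ :=
  Real.sqrt (∑ i, ∑ j, (‖P.1 i j‖ ^ 2 + ‖P.2 i j‖ ^ 2))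

/-- Euclidean distance on `ℂ²`. -/
noncomputable def distC2 (p q : ℂ × ℂ) : ℝ :=
  Real.sqrt (‖p.1 - q.1‖ ^ 2 + ‖p.2 - q.2‖ ^ 2)

theorem pencilPoly_eq_prod_of_upperTriangular {n : ℕ}
    {P : Matrix (Fin n) (Fin n) ℂ × Matrix (Fin n) (Fin n) ℂ}
    (h₁ : ∀ i j : Fin n, j < i → P.1 i j = 0) (h₂ : ∀ i j : Fin n, j < i → P.2 i j = 0) :
    pencilPoly P =
      ∏ i, (Polynomial.C (P.1 i i) + Polynomial.X * Polynomial.C (P.2 i i)) := by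
  rw [pencilPoly, Matrix.det_of_isUpperTriangular]
  · simp
  · intro i j hij
    simp [h₁ i j hij, h₂ i j hij]

theorem mem_SOmega1_iff {Ω : Set (OnePoint ℂ)} {a b : ℂ} :
    (a, b) ∈ SOmega1 Ω ↔
      Polynomial.C a + Polynomial.X * Polynomial.C b ≠ 0 ∧
      (∀ z : ℂ, a + z * b = 0 → (z : OnePoint ℂ) ∈ Ω) ∧
      (b = 0 → (OnePoint.infty : OnePoint ℂ) ∈ Ω) := by
  have hzero : Polynomial.C a + Polynomial.X * Polynomial.C b = 0 ↔ (a, b) = (0, 0) := by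
    constructor
    · intro h
      have h0 := congrArg (fun p => Polynomial.coeff p 0) h
      have h1 := congrArg (fun p => Polynomial.coeff p 1) h
      simp [Polynomial.coeff_C] at h0 h1
      simp [h0, h1]
    · intro h
      obtain ⟨rfl, rfl⟩ := Prod.mk.inj h
      simp
  simp only [SOmega1, Set.mem_ofPred_eq, ne_eq, hzero]
  refine and_congr_right fun hab => and_congr_left fun _ => ⟨fun h z hz => ?_, fun h hb => ?_⟩
  · have hb : b ≠ 0 := by
      rintro rfl
      exact hab (by simpa using hz)
    have hzab : z = -a / b := by
      rw [eq_div_iff hb]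
      linear_combination hz
    exact hzab ▸ h hb
  · exact h _ (by field_simp; ring)

theorem mem_Stri_iff {n : ℕ} {Ω : Set (OnePoint ℂ)}
    {P : Matrix (Fin n) (Fin n) ℂ × Matrix (Fin n) (Fin n) ℂ} :
    P ∈ Stri Ω n ↔ (∀ i, (P.1 i i, P.2 i i) ∈ SOmega1 Ω) ∧
      (∀ i j : Fin n, j < i → P.1 i j = 0) ∧ (∀ i j : Fin n, j < i → P.2 i j = 0) := by
  refine and_congr_left fun ⟨h₁, h₂⟩ => ?_
  have hdet : P.2.det = ∏ i, P.2 i i :=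
    Matrix.det_of_isUpperTriangular fun i j hij => h₂ i j hij
  simp only [SOmega, Set.mem_ofPred_eq, pencilPoly_eq_prod_of_upperTriangular h₁ h₂, hdet,
    mem_SOmega1_iff, Polynomial.IsRoot, Polynomial.eval_prod, Finset.prod_eq_zero_iff,
    Finset.prod_ne_zero_iff, Finset.mem_univ, true_and, true_imp_iff, Polynomial.eval_add,
    Polynomial.eval_mul, Polynomial.eval_C, Polynomial.eval_X, forall_exists_index, forall_and]
  exact and_congr_right fun _ => and_congr_left fun _ => forall_comm

theorem mem_closure_Stri_of_diag {n : ℕ} {Ω : Set (OnePoint ℂ)}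
    {P : Matrix (Fin n) (Fin n) ℂ × Matrix (Fin n) (Fin n) ℂ}
    (hdiag : ∀ i, (P.1 i i, P.2 i i) ∈ closure (SOmega1 Ω))
    (h₁ : ∀ i j : Fin n, j < i → P.1 i j = 0) (h₂ : ∀ i j : Fin n, j < i → P.2 i j = 0) :
    P ∈ closure (Stri Ω n) := by
  let f : (Fin n → ℂ × ℂ) → Matrix (Fin n) (Fin n) ℂ × Matrix (Fin n) (Fin n) ℂ := fun d =>
    (fun i j => if i = j then (d i).1 else P.1 i j, fun i j => if i = j then (d i).2 else P.2 i j)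
  have hf : Continuous f := by
    refine Continuous.prodMk ?_ ?_ <;>
    · refine continuous_pi fun i => continuous_pi fun j => ?_
      by_cases hij : i = j
      · simp only [hij, if_true]
        fun_prop
      · simp only [hij, if_false]
        fun_prop
  have hd : (fun i => (P.1 i i, P.2 i i)) ∈ closure (Set.univ.pi fun _ : Fin n => SOmega1 Ω) := by
    rw [closure_pi_set]
    exact fun i _ => hdiag i
  have hfP : f (fun i => (P.1 i i, P.2 i i)) = P := by
    refine Prod.ext ?_ ?_ <;>
    · ext i j
      by_cases hij : i = j <;> simp [f, hij]
  rw [← hfP]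
  refine map_mem_closure hf hd fun d hdm => mem_Stri_iff.2 ⟨fun i => ?_, ?_, ?_⟩
  · simpa [f] using hdm i (Set.mem_univ i)
  · intro i j hij
    simp [f, hij.ne', h₁ i j hij]
  · intro i j hij
    simp [f, hij.ne', h₂ i j hij]

theorem diag_mem_closure_of_mem_closure_Stri {n : ℕ} {Ω : Set (OnePoint ℂ)}
    {P : Matrix (Fin n) (Fin n) ℂ × Matrix (Fin n) (Fin n) ℂ} (hP : P ∈ closure (Stri Ω n))
    (i : Fin n) : (P.1 i i, P.2 i i) ∈ closure (SOmega1 Ω) :=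
  map_mem_closure
    (f := fun P : Matrix (Fin n) (Fin n) ℂ × Matrix (Fin n) (Fin n) ℂ => (P.1 i i, P.2 i i))
    ((continuous_fst.matrix_elem i i).prodMk (continuous_snd.matrix_elem i i)) hP
    fun _ hQ => (mem_Stri_iff.1 hQ).1 i

theorem lower_eq_zero_of_mem_closure_Stri {n : ℕ} {Ω : Set (OnePoint ℂ)}
    {P : Matrix (Fin n) (Fin n) ℂ × Matrix (Fin n) (Fin n) ℂ} (hP : P ∈ closure (Stri Ω n))
    {i j : Fin n} (hij : j < i) : P.1 i j = 0 ∧ P.2 i j = 0 := by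
  have hclosed : IsClosed {Q : Matrix (Fin n) (Fin n) ℂ × Matrix (Fin n) (Fin n) ℂ |
      Q.1 i j = 0 ∧ Q.2 i j = 0} :=
    (isClosed_eq (continuous_fst.matrix_elem i j) continuous_const).inter
      (isClosed_eq (continuous_snd.matrix_elem i j) continuous_const)
  have hsub : Stri Ω n ⊆ {Q | Q.1 i j = 0 ∧ Q.2 i j = 0} :=
    fun Q hQ => ⟨hQ.2.1 i j hij, hQ.2.2 i j hij⟩
  exact closure_minimal hsub hclosed hP

/-- `T(A,B)` (strictly upper part of `(A,B)`, diagonal entries projected by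
`p_Ω` onto the closure of `S(Ω,1)`, strictly lower part zero) is a nearest point to `(A,B)`
in the closure of `S_tri(Ω,n)`. -/
theorem nearest_triangular_pencil {n : ℕ} (Ω : Set (OnePoint ℂ))
    (hclosed : IsClosed Ω) (hne : Ω.Nonempty)
    (pΩ : ℂ × ℂ → ℂ × ℂ)
    (hmem : ∀ p : ℂ × ℂ, pΩ p ∈ closure (SOmega1 Ω))
    (hdist : ∀ p : ℂ × ℂ, ∀ q ∈ closure (SOmega1 Ω), distC2 p (pΩ p) ≤ distC2 p q)
    (A B T₀ T₁ : Matrix (Fin n) (Fin n) ℂ)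
    (hT₀ : ∀ i j : Fin n, T₀ i j =
      if i < j then A i j else if i = j then (pΩ (A i i, B i i)).1 else 0)
    (hT₁ : ∀ i j : Fin n, T₁ i j =
      if i < j then B i j else if i = j then (pΩ (A i i, B i i)).2 else 0) :
    (T₀, T₁) ∈ closure (Stri Ω n) ∧
    ∀ P ∈ closure (Stri Ω n),
      pencilNorm ((A, B) - (T₀, T₁)) ≤ pencilNorm ((A, B) - P) := by
  constructor
  · refine mem_closure_Stri_of_diag (fun i => ?_) (fun i j hij => ?_) (fun i j hij => ?_)
    · simpa [hT₀, hT₁] using hmem (A i i, B i i)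
    · simp [hT₀, hij.not_gt, hij.ne']
    · simp [hT₁, hij.not_gt, hij.ne']
  · intro P hP
    refine Real.sqrt_le_sqrt (Finset.sum_le_sum fun i _ => Finset.sum_le_sum fun j _ => ?_)
    simp only [Prod.fst_sub, Prod.snd_sub, Matrix.sub_apply, hT₀, hT₁]
    rcases lt_trichotomy i j with hij | rfl | hij
    · simp only [hij, if_true, sub_self, norm_zero, ne_eq, OfNat.ofNat_ne_zero, not_false_eq_true,
        zero_pow, add_zero]
      positivity
    · have h := hdist (A i i, B i i) _ (diag_mem_closure_of_mem_closure_Stri hP i)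
      rw [distC2, distC2, Real.sqrt_le_sqrt_iff (by positivity)] at h
      simpa using h
    · obtain ⟨h₁, h₂⟩ := lower_eq_zero_of_mem_closure_Stri hP hij
      simp [hij.not_gt, hij.ne', h₁, h₂]
end

section
/- Let Ω be a nonempty closed subset of the Riemann sphere ℂ ∪ {∞}. Then the closure of S(Ω,n) equals the union over all pairs of unitary matrices Q, Z ∈ U(n) of the sets { (Q S Z, Q T Z) : (S,T) ∈ closure of S_tri(Ω,n) }. -/
open Matrix

/-- A square matrix bordered by a row and a column of the identity matrix. -/
def borderOne {n : ℕ} (U : Matrix (Fin n) (Fin n) ℂ) : Matrix (Fin (n + 1)) (Fin (n + 1)) ℂ :=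
  Matrix.of fun i j => Fin.cases (Fin.cases 1 (fun _ => 0) j) (fun i' => Fin.cases 0 (U i') j) i

section borderOne

variable {n : ℕ} (U : Matrix (Fin n) (Fin n) ℂ)

@[simp] lemma borderOne_zero_zero : borderOne U 0 0 = 1 := rfl

@[simp] lemma borderOne_zero_succ (j : Fin n) : borderOne U 0 j.succ = 0 := rfl

@[simp] lemma borderOne_succ_zero (i : Fin n) : borderOne U i.succ 0 = 0 := rfl

@[simp] lemma borderOne_succ_succ (i j : Fin n) : borderOne U i.succ j.succ = U i j := rfl

lemma borderOne_mem_unitaryGroup (hU : U ∈ unitaryGroup (Fin n) ℂ) :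
    borderOne U ∈ unitaryGroup (Fin (n + 1)) ℂ := by
  rw [mem_unitaryGroup_iff] at hU ⊢
  ext i j
  have h := fun i j => congrFun (congrFun hU i) j
  simp only [mul_apply, star_apply] at h
  refine Fin.cases ?_ (fun i => ?_) i <;> refine Fin.cases ?_ (fun j => ?_) j <;>
    simp [mul_apply, Fin.sum_univ_succ, star_apply, one_apply, Fin.succ_ne_zero,
      (Fin.succ_ne_zero _).symm]
  simpa [one_apply] using h i j

lemma borderOne_mul_mul_isUpperTriangular (V : Matrix (Fin n) (Fin n) ℂ)
    (M : Matrix (Fin (n + 1)) (Fin (n + 1)) ℂ) (hM : ∀ i : Fin n, M i.succ 0 = 0)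
    (h : (U * M.submatrix Fin.succ Fin.succ * V).IsUpperTriangular) :
    (borderOne U * M * borderOne V).IsUpperTriangular := by
  intro i j hij
  induction i using Fin.cases with
  | zero => exact absurd hij (Fin.not_lt_zero j)
  | succ i =>
    induction j using Fin.cases with
    | zero => simp [mul_apply, Fin.sum_univ_succ, hM]
    | succ j =>
      have := h (i := i) (j := j) (Fin.succ_lt_succ_iff.mp hij)
      simpa [mul_apply, Fin.sum_univ_succ] using this

end borderOne

lemma exists_unitary_col_zero_eq_smul {n : ℕ} (x : Fin (n + 1) → ℂ) (hx : x ≠ 0) :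
    ∃ V ∈ unitaryGroup (Fin (n + 1)) ℂ, ∃ c : ℂ, c ≠ 0 ∧ ∀ i, V i 0 = c * x i := by
  have hx' : WithLp.toLp 2 x ≠ 0 := fun h => hx (by simpa using h)
  set c : ℂ := (‖WithLp.toLp 2 x‖ : ℂ)⁻¹
  have hon : Orthonormal ℂ (Set.domRestrict {(0 : Fin (n + 1))} fun _ => c • WithLp.toLp 2 x) := by
    refine ⟨fun _ => norm_smul_inv_norm hx', fun i j hij => absurd (Subsingleton.elim i j) hij⟩
  obtain ⟨b, hb⟩ := hon.exists_orthonormalBasis_extension_of_card_eq (by simp)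
  refine ⟨_, (EuclideanSpace.basisFun (Fin (n + 1)) ℂ).toMatrix_orthonormalBasis_mem_unitary b,
    c, by simpa [c] using hx, fun i => ?_⟩
  simp [Module.Basis.toMatrix_apply, hb 0 rfl]

lemma exists_common_direction {ι : Type*} [Fintype ι] [DecidableEq ι] [Nonempty ι]
    (A B : Matrix ι ι ℂ) :
    ∃ x : ι → ℂ, x ≠ 0 ∧ ∃ y : ι → ℂ, y ≠ 0 ∧ ∃ a b : ℂ, A *ᵥ x = a • y ∧ B *ᵥ x = b • y := by
  suffices ∃ x : ι → ℂ, x ≠ 0 ∧ ∃ y : ι → ℂ, ∃ a b : ℂ, A *ᵥ x = a • y ∧ B *ᵥ x = b • y by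
    obtain ⟨x, hx, y, a, b, ha, hb⟩ := this
    by_cases hy : y = 0
    · exact ⟨x, hx, 1, one_ne_zero, 0, 0, by simp [ha, hy], by simp [hb, hy]⟩
    · exact ⟨x, hx, y, hy, a, b, ha, hb⟩
  by_cases hB : B.det = 0
  · obtain ⟨x, hx, h⟩ := exists_mulVec_eq_zero_iff.mpr hB
    exact ⟨x, hx, A *ᵥ x, 1, 0, by simp, by simp [h]⟩
  · obtain ⟨μ, hμ⟩ := Module.End.exists_eigenvalue (toLin' (B⁻¹ * A))
    obtain ⟨x, hx⟩ := hμ.exists_hasEigenvector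
    refine ⟨x, hx.2, B *ᵥ x, μ, 1, ?_, by simp⟩
    have h := congrArg (B *ᵥ ·) hx.apply_eq_smul
    simpa [mulVec_mulVec, mul_nonsing_inv_cancel_left _ _ (isUnit_iff_ne_zero.mpr hB),
      mulVec_smul] using h

/-- **Generalized Schur decomposition**: two square matrices are simultaneously brought to upper
triangular form by a unitary equivalence. -/
theorem exists_unitary_mul_mul_isUpperTriangular : ∀ {n : ℕ} (A B : Matrix (Fin n) (Fin n) ℂ),
    ∃ U ∈ unitaryGroup (Fin n) ℂ, ∃ V ∈ unitaryGroup (Fin n) ℂ,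
      (U * A * V).IsUpperTriangular ∧ (U * B * V).IsUpperTriangular
  | 0, _, _ => ⟨1, one_mem _, 1, one_mem _, fun i => i.elim0, fun i => i.elim0⟩
  | n + 1, A, B => by
    obtain ⟨x, hx, y, hy, a, b, hA, hB⟩ := exists_common_direction A B
    obtain ⟨V, hV, d, -, hVx⟩ := exists_unitary_col_zero_eq_smul x hx
    obtain ⟨W, hW, c, hc, hWy⟩ := exists_unitary_col_zero_eq_smul y hy
    have key : ∀ (M : Matrix (Fin (n + 1)) (Fin (n + 1)) ℂ) (m : ℂ), M *ᵥ x = m • y →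
        ∀ i : Fin n, (star W * M * V) i.succ 0 = 0 := by
      intro M m hM i
      have hcol : ∀ k, (M * V) k 0 = d * m * c⁻¹ * W k 0 := by
        intro k
        have := congrFun hM k
        simp only [mulVec, dotProduct, Pi.smul_apply, smul_eq_mul] at this
        simp only [mul_apply, hVx, hWy, mul_left_comm _ d, ← Finset.mul_sum, this]
        field_simp
      have horth : (star W * W) i.succ 0 = 0 := by
        rw [mem_unitaryGroup_iff'.mp hW, one_apply_ne (Fin.succ_ne_zero i)]
      rw [mul_apply] at horth
      rw [Matrix.mul_assoc, mul_apply]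
      simp only [hcol, mul_left_comm _ (d * m * c⁻¹), ← Finset.mul_sum, horth, mul_zero]
    obtain ⟨U', hU', V', hV', hA', hB'⟩ := exists_unitary_mul_mul_isUpperTriangular
      ((star W * A * V).submatrix Fin.succ Fin.succ) ((star W * B * V).submatrix Fin.succ Fin.succ)
    refine ⟨borderOne U' * star W,
      mul_mem (borderOne_mem_unitaryGroup U' hU') (Unitary.star_mem hW),
      V * borderOne V', mul_mem hV (borderOne_mem_unitaryGroup V' hV'), ?_, ?_⟩
    · simpa only [Matrix.mul_assoc] using
        borderOne_mul_mul_isUpperTriangular U' V' _ (key A a hA) hA'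
    · simpa only [Matrix.mul_assoc] using
        borderOne_mul_mul_isUpperTriangular U' V' _ (key B b hB) hB'

lemma pencilPoly_mul_mul {n : ℕ} (U V : Matrix (Fin n) (Fin n) ℂ)
    (P : Matrix (Fin n) (Fin n) ℂ × Matrix (Fin n) (Fin n) ℂ) :
    pencilPoly (U * P.1 * V, U * P.2 * V) =
      Polynomial.C (U.det * V.det) * pencilPoly P := by
  have h : (U * P.1 * V).map Polynomial.C +
      (Polynomial.X : Polynomial ℂ) • (U * P.2 * V).map Polynomial.C =
      U.map Polynomial.C * (P.1.map Polynomial.C +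
        (Polynomial.X : Polynomial ℂ) • P.2.map Polynomial.C) * V.map Polynomial.C := by
    simp only [Matrix.map_mul, Matrix.mul_add, Matrix.add_mul, Matrix.mul_smul, Matrix.smul_mul]
  have hdet (M : Matrix (Fin n) (Fin n) ℂ) :
      (M.map Polynomial.C).det = Polynomial.C M.det :=
    ((Polynomial.C : ℂ →+* Polynomial ℂ).map_det M).symm
  rw [pencilPoly, h, det_mul, det_mul, hdet, hdet, pencilPoly, Polynomial.C_mul]
  ring

lemma mul_mul_mem_SOmega {n : ℕ} {Ω : Set (OnePoint ℂ)} {U V : Matrix (Fin n) (Fin n) ℂ}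
    (hU : U ∈ unitaryGroup (Fin n) ℂ) (hV : V ∈ unitaryGroup (Fin n) ℂ)
    {P : Matrix (Fin n) (Fin n) ℂ × Matrix (Fin n) (Fin n) ℂ} (hP : P ∈ SOmega Ω n) :
    (U * P.1 * V, U * P.2 * V) ∈ SOmega Ω n := by
  have hdet {W : Matrix (Fin n) (Fin n) ℂ} (hW : W ∈ unitaryGroup (Fin n) ℂ) : W.det ≠ 0 :=
    (isUnit_det_of_right_inverse (mem_unitaryGroup_iff.mp hW)).ne_zero
  have h := mul_ne_zero (hdet hU) (hdet hV)
  obtain ⟨h1, h2, h3⟩ := hP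
  refine ⟨?_, fun z hz => h2 z ?_, fun h0 => h3 ?_⟩
  · rw [pencilPoly_mul_mul]
    exact mul_ne_zero (Polynomial.C_ne_zero.mpr h) h1
  · rw [pencilPoly_mul_mul, Polynomial.IsRoot, Polynomial.eval_mul, Polynomial.eval_C] at hz
    exact (mul_eq_zero.mp hz).resolve_left h
  · simpa [det_mul, hdet hU, hdet hV] using h0

lemma isCompact_unitaryGroup (ι : Type*) [Fintype ι] [DecidableEq ι] :
    IsCompact (unitaryGroup ι ℂ : Set (Matrix ι ι ℂ)) := by
  have hK : IsCompact (Set.univ.pi fun _ => Set.univ.pi fun _ => Metric.closedBall 0 1 :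
      Set (Matrix ι ι ℂ)) :=
    isCompact_univ_pi fun _ => isCompact_univ_pi fun _ => isCompact_closedBall 0 1
  refine hK.of_isClosed_subset ?_ fun U hU i _ j _ => ?_
  · have : (unitaryGroup ι ℂ : Set (Matrix ι ι ℂ)) = {U | U * star U = 1} :=
      Set.ext fun U => mem_unitaryGroup_iff
    rw [this]
    exact isClosed_eq (by fun_prop) continuous_const
  · simpa using entry_norm_bound_of_unitary hU i j

/-- the closure of `S(Ω,n)` is the union, over unitary `Q, Z`, of the images
`Q · (closure S_tri(Ω,n)) · Z`. -/
theorem closure_SOmega_eq_union_unitary {n : ℕ} (Ω : Set (OnePoint ℂ))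
    (hclosed : IsClosed Ω) (hne : Ω.Nonempty) :
    closure (SOmega Ω n) =
      {P : Matrix (Fin n) (Fin n) ℂ × Matrix (Fin n) (Fin n) ℂ |
        ∃ Q ∈ Matrix.unitaryGroup (Fin n) ℂ, ∃ Z ∈ Matrix.unitaryGroup (Fin n) ℂ,
          ∃ S ∈ closure (Stri Ω n), P = (Q * S.1 * Z, Q * S.2 * Z)} := by
  have cancel {Q Q' Z Z' : Matrix (Fin n) (Fin n) ℂ} (hQ : Q * Q' = 1) (hZ : Z' * Z = 1)
      (M : Matrix (Fin n) (Fin n) ℂ) : Q * (Q' * M * Z') * Z = M := by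
    rw [show Q * (Q' * M * Z') * Z = (Q * Q') * M * (Z' * Z) by simp only [Matrix.mul_assoc],
      hQ, hZ, Matrix.one_mul, Matrix.mul_one]
  apply Set.Subset.antisymm
  · apply closure_minimal
    · intro P hP
      obtain ⟨U, hU, V, hV, h1, h2⟩ := exists_unitary_mul_mul_isUpperTriangular P.1 P.2
      refine ⟨star U, Unitary.star_mem hU, star V, Unitary.star_mem hV,
        (U * P.1 * V, U * P.2 * V), subset_closure ⟨mul_mul_mem_SOmega hU hV hP,
          fun _ _ h => h1 h, fun _ _ h => h2 h⟩, ?_⟩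
      rw [cancel (mem_unitaryGroup_iff'.mp hU) (mem_unitaryGroup_iff.mp hV),
        cancel (mem_unitaryGroup_iff'.mp hU) (mem_unitaryGroup_iff.mp hV)]
    · have : CompactSpace (unitaryGroup (Fin n) ℂ) :=
        isCompact_iff_compactSpace.mp (isCompact_unitaryGroup (Fin n))
      let f : (unitaryGroup (Fin n) ℂ × unitaryGroup (Fin n) ℂ) ×
          (Matrix (Fin n) (Fin n) ℂ × Matrix (Fin n) (Fin n) ℂ) →
          Matrix (Fin n) (Fin n) ℂ × Matrix (Fin n) (Fin n) ℂ := fun p =>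
        (star (p.1.1 : Matrix (Fin n) (Fin n) ℂ) * p.2.1 * star (p.1.2 : Matrix (Fin n) (Fin n) ℂ),
          star (p.1.1 : Matrix (Fin n) (Fin n) ℂ) * p.2.2 * star (p.1.2 : Matrix (Fin n) (Fin n) ℂ))
      have hf : Continuous f := by fun_prop
      convert isClosedMap_snd_of_compactSpace _ (isClosed_closure.preimage hf) using 1
      ext P
      constructor
      · rintro ⟨Q, hQ, Z, hZ, S, hS, rfl⟩
        refine ⟨((⟨Q, hQ⟩, ⟨Z, hZ⟩), _), ?_, rfl⟩
        simpa only [f, Set.mem_preimage, Prod.mk.eta,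
          cancel (mem_unitaryGroup_iff'.mp hQ) (mem_unitaryGroup_iff.mp hZ)] using hS
      · rintro ⟨⟨⟨Q, Z⟩, P⟩, hS, rfl⟩
        refine ⟨Q, Q.2, Z, Z.2, _, hS, ?_⟩
        simp only [f, cancel (mem_unitaryGroup_iff.mp Q.2) (mem_unitaryGroup_iff'.mp Z.2)]
  · rintro _ ⟨Q, hQ, Z, hZ, S, hS, rfl⟩
    exact map_mem_closure (f := fun S : Matrix (Fin n) (Fin n) ℂ × Matrix (Fin n) (Fin n) ℂ =>
      (Q * S.1 * Z, Q * S.2 * Z)) (by fun_prop) hS fun S hS => mul_mul_mem_SOmega hQ hZ hS.1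
end

section
/- Let Ω be a nonempty closed subset of the Riemann sphere ℂ ∪ {∞}. If an n×n pencil (A,B) belongs to the closure of S(Ω,n) but not to S(Ω,n) itself, then (A,B) is singular, i.e. det(A + X·B) is the zero polynomial. -/
open Matrix

open Polynomial in
/-- Comparing the values of a complex polynomial at two points through the distances to its
roots. -/
theorem norm_eval_le_of_roots {f : ℂ[X]} {w z : ℂ} {C : ℝ}
    (h : ∀ a ∈ f.roots, ‖w - a‖ ≤ C * ‖z - a‖) :
    ‖f.eval w‖ ≤ C ^ f.natDegree * ‖f.eval z‖ := by
  have hf := IsAlgClosed.splits f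
  have hnorm (x : ℂ) : ‖f.eval x‖ = ‖f.leadingCoeff‖ * (f.roots.map (‖x - ·‖)).prod := by
    rw [hf.eval_eq_prod_roots, norm_mul]
    congr 1
    simpa using map_multiset_prod (normHom : ℂ →*₀ ℝ) (f.roots.map (x - ·))
  have hprod := Multiset.prod_map_le_prod_map₀ (s := f.roots) (‖w - ·‖) (C * ‖z - ·‖)
    (fun _ _ ↦ norm_nonneg _) h
  rw [Multiset.prod_map_mul, Multiset.map_const', Multiset.prod_replicate,
    ← hf.natDegree_eq_card_roots] at hprod
  rw [hnorm w, hnorm z, mul_left_comm]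
  gcongr

open Polynomial in
/-- A complex polynomial is bounded in terms of its leading coefficient and the distances to its
roots. -/
theorem norm_eval_le_leadingCoeff_of_roots {f : ℂ[X]} {w : ℂ} {C : ℝ}
    (h : ∀ a ∈ f.roots, ‖w - a‖ ≤ C) :
    ‖f.eval w‖ ≤ C ^ f.natDegree * ‖f.leadingCoeff‖ := by
  have hf := IsAlgClosed.splits f
  have hnorm : ‖f.eval w‖ = ‖f.leadingCoeff‖ * (f.roots.map (‖w - ·‖)).prod := by
    rw [hf.eval_eq_prod_roots, norm_mul]
    congr 1
    simpa using map_multiset_prod (normHom : ℂ →*₀ ℝ) (f.roots.map (w - ·))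
  have hprod := Multiset.prod_map_le_prod_map₀ (s := f.roots) (‖w - ·‖) (fun _ ↦ C)
    (fun _ _ ↦ norm_nonneg _) h
  rw [Multiset.map_const', Multiset.prod_replicate, ← hf.natDegree_eq_card_roots] at hprod
  rw [hnorm, mul_comm]
  gcongr

section Pencil

variable {n : ℕ}

theorem pencilPoly_eq (P : Matrix (Fin n) (Fin n) ℂ × Matrix (Fin n) (Fin n) ℂ) :
    pencilPoly P =
      det ((Polynomial.X : Polynomial ℂ) • P.2.map Polynomial.C + P.1.map Polynomial.C) := by
  rw [pencilPoly, add_comm]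

theorem natDegree_pencilPoly_le (P : Matrix (Fin n) (Fin n) ℂ × Matrix (Fin n) (Fin n) ℂ) :
    (pencilPoly P).natDegree ≤ n := by
  simpa [pencilPoly_eq] using Polynomial.natDegree_det_X_add_C_le P.2 P.1

theorem coeff_pencilPoly_card (P : Matrix (Fin n) (Fin n) ℂ × Matrix (Fin n) (Fin n) ℂ) :
    (pencilPoly P).coeff n = P.2.det := by
  simpa [pencilPoly_eq] using Polynomial.coeff_det_X_add_C_card P.2 P.1

theorem eval_pencilPoly (P : Matrix (Fin n) (Fin n) ℂ × Matrix (Fin n) (Fin n) ℂ) (w : ℂ) :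
    (pencilPoly P).eval w = (P.1 + w • P.2).det := by
  rw [pencilPoly, ← Polynomial.coe_evalRingHom, RingHom.map_det]
  congr 1
  ext i j
  simpa using mul_comm (P.2 i j) w

theorem continuous_eval_pencilPoly (w : ℂ) :
    Continuous fun P : Matrix (Fin n) (Fin n) ℂ × Matrix (Fin n) (Fin n) ℂ ↦
      (pencilPoly P).eval w := by
  simp only [eval_pencilPoly]
  fun_prop

/-- A limit of pencils whose eigenvalues avoid a neighbourhood of `z`, if it has the eigenvalue
`z`, is singular. -/
theorem pencilPoly_eq_zero_of_isRoot {Ω : Set (OnePoint ℂ)} (hclosed : IsClosed Ω)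
    {P : Matrix (Fin n) (Fin n) ℂ × Matrix (Fin n) (Fin n) ℂ} (hmem : P ∈ closure (SOmega Ω n))
    {z : ℂ} (hz : (pencilPoly P).IsRoot z) (hzΩ : (z : OnePoint ℂ) ∉ Ω) : pencilPoly P = 0 := by
  obtain ⟨r, hr, hball⟩ := Metric.isOpen_iff.1
    (hclosed.preimage OnePoint.continuous_coe).isOpen_compl z hzΩ
  refine Polynomial.funext fun w ↦ ?_
  set C : ℝ := 1 + ‖w - z‖ / r
  have hC : 1 ≤ C := le_add_of_nonneg_right (by positivity)
  have hsub : closure (SOmega Ω n) ⊆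
      {Q | ‖(pencilPoly Q).eval w‖ ≤ C ^ n * ‖(pencilPoly Q).eval z‖} := by
    refine closure_minimal (fun Q hQ ↦ ?_) (isClosed_le (continuous_eval_pencilPoly w).norm
      (continuous_const.mul (continuous_eval_pencilPoly z).norm))
    refine (norm_eval_le_of_roots (C := C) fun a ha ↦ ?_).trans
      (mul_le_mul_of_nonneg_right (pow_le_pow_right₀ hC (natDegree_pencilPoly_le Q))
        (norm_nonneg _))
    have har : r ≤ ‖z - a‖ := by
      by_contra! hlt
      exact hball (by rwa [mem_ball_iff_norm'])
        (hQ.2.1 a (Polynomial.isRoot_of_mem_roots ha))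
    calc ‖w - a‖ ≤ ‖z - a‖ + ‖w - z‖ := by
          simpa [add_comm] using norm_sub_le_norm_sub_add_norm_sub w z a
      _ ≤ ‖z - a‖ + ‖w - z‖ / r * ‖z - a‖ := by
          gcongr
          rw [div_mul_eq_mul_div, le_div_iff₀ hr]
          gcongr
      _ = C * ‖z - a‖ := by ring
  have hle : ‖(pencilPoly P).eval w‖ ≤ C ^ n * ‖(pencilPoly P).eval z‖ := hsub hmem
  rw [hz.eq_zero] at hle
  simpa using hle

/-- A limit of pencils whose eigenvalues avoid a neighbourhood of `∞`, if it has the eigenvalue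
`∞`, is singular. -/
theorem pencilPoly_eq_zero_of_det_eq_zero {Ω : Set (OnePoint ℂ)} (hclosed : IsClosed Ω)
    {P : Matrix (Fin n) (Fin n) ℂ × Matrix (Fin n) (Fin n) ℂ} (hmem : P ∈ closure (SOmega Ω n))
    (hdet : P.2.det = 0) (hΩ : (OnePoint.infty : OnePoint ℂ) ∉ Ω) : pencilPoly P = 0 := by
  obtain ⟨R, hR⟩ :=
    ((OnePoint.isClosed_iff_of_notMem hΩ).1 hclosed).2.isBounded.exists_norm_le
  refine Polynomial.funext fun w ↦ ?_
  have hsub : closure (SOmega Ω n) ⊆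
      {Q | ‖(pencilPoly Q).eval w‖ ≤ (‖w‖ + R) ^ n * ‖Q.2.det‖} := by
    refine closure_minimal (fun Q hQ ↦ ?_) (isClosed_le (continuous_eval_pencilPoly w).norm
      (by fun_prop))
    have hcoeff : (pencilPoly Q).coeff n ≠ 0 := by
      rw [coeff_pencilPoly_card]
      exact fun h ↦ hΩ (hQ.2.2 h)
    have hdeg : (pencilPoly Q).natDegree = n :=
      (natDegree_pencilPoly_le Q).antisymm (Polynomial.le_natDegree_of_ne_zero hcoeff)
    have hle := norm_eval_le_leadingCoeff_of_roots (f := pencilPoly Q) (w := w) (C := ‖w‖ + R)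
      fun a ha ↦ (norm_sub_le w a).trans (add_le_add_right
        (hR a (hQ.2.1 a (Polynomial.isRoot_of_mem_roots ha))) _)
    rwa [Polynomial.leadingCoeff, hdeg, coeff_pencilPoly_card] at hle
  have hle : ‖(pencilPoly P).eval w‖ ≤ (‖w‖ + R) ^ n * ‖P.2.det‖ := hsub hmem
  rw [hdet] at hle
  simpa using hle

end Pencil

/-- a pencil in the closure of `S(Ω,n)` which is not in `S(Ω,n)` itself
is singular, i.e. `det(A + X·B)` is the zero polynomial. -/
theorem singular_on_boundary {n : ℕ} (Ω : Set (OnePoint ℂ))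
    (hclosed : IsClosed Ω) (hne : Ω.Nonempty)
    (P : Matrix (Fin n) (Fin n) ℂ × Matrix (Fin n) (Fin n) ℂ)
    (hmem : P ∈ closure (SOmega Ω n)) (hnot : P ∉ SOmega Ω n) :
    pencilPoly P = 0 := by
  by_contra hP
  refine hnot ⟨hP, fun z hz ↦ ?_, fun hdet ↦ ?_⟩ <;> by_contra hΩ
  · exact hP (pencilPoly_eq_zero_of_isRoot hclosed hmem hz hΩ)
  · exact hP (pencilPoly_eq_zero_of_det_eq_zero hclosed hmem hdet hΩ)
end

section
/- Let C = {x ∈ ℝ⁴ : x₁x₃ + x₂x₄ ≥ 0} and let a = (a₁,a₂,a₃,a₄) ∈ ℝ⁴ satisfy a₁a₃ + a₂a₄ < 0. Set α = ‖a‖² / (2(a₁a₃ + a₂a₄)) and assume α < −1, and set λ = α + √(α² − 1). Then the point x* = (1 − λ²)^{−1}·(a₁ − λa₃, a₂ − λa₄, a₃ − λa₁, a₄ − λa₂) satisfies x*₁x*₃ + x*₂x*₄ = 0 (so x* ∈ C), the Euclidean distance from a to C equals ‖a − x*‖, and this distance equals √(λ(a₁a₃ + a₂a₄)). -/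
theorem add_sqrt_sq_sub_one_mem_Ioo {t : ℝ} (ht : t < -1) :
    t + Real.sqrt (t ^ 2 - 1) ∈ Set.Ioo (-1) 0 := by
  constructor
  · have h : -1 - t < Real.sqrt (t ^ 2 - 1) := Real.lt_sqrt_of_sq_lt (by nlinarith)
    linarith
  · have h : Real.sqrt (t ^ 2 - 1) < -t := (Real.sqrt_lt' (by linarith)).2 (by linarith)
    linarith

theorem sq_add_sqrt_sq_sub_one {t : ℝ} (ht : t < -1) :
    (t + Real.sqrt (t ^ 2 - 1)) ^ 2 - 2 * t * (t + Real.sqrt (t ^ 2 - 1)) + 1 = 0 := by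
  have h : Real.sqrt (t ^ 2 - 1) ^ 2 = t ^ 2 - 1 := Real.sq_sqrt (by nlinarith)
  linear_combination h

theorem EuclideanSpace.dist_sq_fin_four (u v : EuclideanSpace ℝ (Fin 4)) :
    dist u v ^ 2 =
      (u 0 - v 0) ^ 2 + (u 1 - v 1) ^ 2 + (u 2 - v 2) ^ 2 + (u 3 - v 3) ^ 2 := by
  rw [EuclideanSpace.dist_eq, Real.sq_sqrt (by positivity)]
  simp [Fin.sum_univ_four, Real.dist_eq, sq_abs]

/-- If `x` is isotropic and `a = x + l J x`, where `J` exchanges the two halves of the coordinates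
and `-1 ≤ l ≤ 0`, then `x` is a nearest point to `a` in the closed Hurwitz stable set. -/
theorem dist_le_dist_of_eq_add_mul_swap {a x y : EuclideanSpace ℝ (Fin 4)} {l : ℝ}
    (hl : -1 ≤ l) (hl' : l ≤ 0) (hx : x 0 * x 2 + x 1 * x 3 = 0)
    (h0 : a 0 = x 0 + l * x 2) (h1 : a 1 = x 1 + l * x 3)
    (h2 : a 2 = x 2 + l * x 0) (h3 : a 3 = x 3 + l * x 1)
    (hy : 0 ≤ y 0 * y 2 + y 1 * y 3) : dist a x ≤ dist a y := by
  refine (sq_le_sq₀ dist_nonneg dist_nonneg).1 (sub_nonneg.1 ?_)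
  have key : dist a y ^ 2 - dist a x ^ 2 =
      (1 + l) * ((y 0 - x 0) ^ 2 + (y 1 - x 1) ^ 2 + (y 2 - x 2) ^ 2 + (y 3 - x 3) ^ 2) +
      (-l) * ((y 0 - x 0 - (y 2 - x 2)) ^ 2 + (y 1 - x 1 - (y 3 - x 3)) ^ 2) +
      2 * ((-l) * (y 0 * y 2 + y 1 * y 3)) := by
    rw [EuclideanSpace.dist_sq_fin_four, EuclideanSpace.dist_sq_fin_four, h0, h1, h2, h3]
    linear_combination 2 * l * hx
  have hl₁ : 0 ≤ 1 + l := by linarith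
  have hl₂ : 0 ≤ -l := by linarith
  rw [key]
  positivity


/-- projection onto the closure `C = {x : x₁x₃ + x₂x₄ ≥ 0}` of the Hurwitz
stable 1×1 pencils, in the non-degenerate case `α < -1`: with `λ = α + √(α² − 1)`, the point
`x* = (1 − λ²)⁻¹ (a₁ − λa₃, a₂ − λa₄, a₃ − λa₁, a₄ − λa₂)` lies on the boundary of `C`,
realizes the Euclidean distance from `a` to `C`, and this distance is
`√(λ(a₁a₃ + a₂a₄))`. (Coordinates are indexed from 0.) -/
theorem hurwitz_projection_formula (a x : EuclideanSpace ℝ (Fin 4)) (α l : ℝ)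
    (ha : a 0 * a 2 + a 1 * a 3 < 0)
    (hα : α = ‖a‖ ^ 2 / (2 * (a 0 * a 2 + a 1 * a 3)))
    (hα1 : α < -1)
    (hl : l = α + Real.sqrt (α ^ 2 - 1))
    (hx0 : x 0 = (1 - l ^ 2)⁻¹ * (a 0 - l * a 2))
    (hx1 : x 1 = (1 - l ^ 2)⁻¹ * (a 1 - l * a 3))
    (hx2 : x 2 = (1 - l ^ 2)⁻¹ * (a 2 - l * a 0))
    (hx3 : x 3 = (1 - l ^ 2)⁻¹ * (a 3 - l * a 1)) :
    x 0 * x 2 + x 1 * x 3 = 0 ∧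
    Metric.infDist a {y : EuclideanSpace ℝ (Fin 4) | 0 ≤ y 0 * y 2 + y 1 * y 3} = dist a x ∧
    Metric.infDist a {y : EuclideanSpace ℝ (Fin 4) | 0 ≤ y 0 * y 2 + y 1 * y 3} =
      Real.sqrt (l * (a 0 * a 2 + a 1 * a 3)) := by
  obtain ⟨hl₁, hl₂⟩ : l ∈ Set.Ioo (-1) 0 := hl ▸ add_sqrt_sq_sub_one_mem_Ioo hα1
  have hquad : l ^ 2 - 2 * α * l + 1 = 0 := hl ▸ sq_add_sqrt_sq_sub_one hα1
  have hnorm : a 0 ^ 2 + a 1 ^ 2 + a 2 ^ 2 + a 3 ^ 2 = 2 * α * (a 0 * a 2 + a 1 * a 3) := by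
    have h : ‖a‖ ^ 2 = a 0 ^ 2 + a 1 ^ 2 + a 2 ^ 2 + a 3 ^ 2 := by
      simp [EuclideanSpace.norm_sq_eq, Fin.sum_univ_four]
    rw [eq_div_iff (by linarith), h] at hα
    linarith
  have hunit : (1 - l ^ 2)⁻¹ * (1 - l ^ 2) = 1 := inv_mul_cancel₀ (by nlinarith)
  have h0 : a 0 = x 0 + l * x 2 := by rw [hx0, hx2]; linear_combination -a 0 * hunit
  have h1 : a 1 = x 1 + l * x 3 := by rw [hx1, hx3]; linear_combination -a 1 * hunit
  have h2 : a 2 = x 2 + l * x 0 := by rw [hx0, hx2]; linear_combination -a 2 * hunit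
  have h3 : a 3 = x 3 + l * x 1 := by rw [hx1, hx3]; linear_combination -a 3 * hunit
  have hx : x 0 * x 2 + x 1 * x 3 = 0 := by
    rw [hx0, hx1, hx2, hx3]
    linear_combination (1 - l ^ 2)⁻¹ ^ 2 *
      ((a 0 * a 2 + a 1 * a 3) * hquad - l * hnorm)
  have hdist : Metric.infDist a {y : EuclideanSpace ℝ (Fin 4) | 0 ≤ y 0 * y 2 + y 1 * y 3} =
      dist a x := by
    refine le_antisymm (Metric.infDist_le_dist_of_mem hx.ge) ?_
    exact (Metric.le_infDist ⟨x, hx.ge⟩).2 fun _ hy =>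
      dist_le_dist_of_eq_add_mul_swap hl₁.le hl₂.le hx h0 h1 h2 h3 hy
  refine ⟨hx, hdist, hdist.trans ?_⟩
  rw [← Real.sqrt_sq (dist_nonneg (x := a) (y := x)), EuclideanSpace.dist_sq_fin_four,
    h0, h1, h2, h3]
  congr 1
  linear_combination -(l + l ^ 3) * hx
end

section
/- Let C = {x ∈ ℝ⁴ : x₁x₃ + x₂x₄ ≥ 0} and let a = (a₁, a₂, −a₁, −a₂) ∈ ℝ⁴ with (a₁,a₂) ≠ (0,0). Then the Euclidean distance from a to C equals √(a₁² + a₂²), and the set of points of C nearest to a is exactly { (a₁ + b₁, a₂ + b₂, b₁, b₂) : (b₁, b₂) ∈ ℝ², (b₁ + a₁/2)² + (b₂ + a₂/2)² = (a₁² + a₂²)/4 }. -/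
/-- Completing the square for the squared distance to `(a₁, a₂, −a₁, −a₂)`. -/
theorem dist_sq_antidiagonal (a x : EuclideanSpace ℝ (Fin 4))
    (h2 : a 2 = -a 0) (h3 : a 3 = -a 1) :
    dist a x ^ 2 = (x 0 - x 2 - a 0) ^ 2 + (x 1 - x 3 - a 1) ^ 2 +
      2 * (x 0 * x 2 + x 1 * x 3) + (a 0 ^ 2 + a 1 ^ 2) := by
  rw [EuclideanSpace.dist_eq, Real.sq_sqrt (by positivity)]
  simp only [Fin.sum_univ_four, Real.dist_eq, sq_abs, h2, h3]
  ring

/-- projection onto the closure `C = {x : x₁x₃ + x₂x₄ ≥ 0}` of the Hurwitz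
stable 1×1 pencils, in the degenerate case `a = (a₁, a₂, −a₁, −a₂) ≠ 0`: the distance from
`a` to `C` is `√(a₁² + a₂²)`, and the nearest points are exactly
`(a₁ + b₁, a₂ + b₂, b₁, b₂)` with `(b₁,b₂)` on the circle of radius `√(a₁² + a₂²)/2`
centered at `−(a₁,a₂)/2`. (Coordinates are indexed from 0.) -/
theorem hurwitz_projection_degenerate (a : EuclideanSpace ℝ (Fin 4))
    (h2 : a 2 = -a 0) (h3 : a 3 = -a 1) (hne : ¬(a 0 = 0 ∧ a 1 = 0)) :
    Metric.infDist a {y : EuclideanSpace ℝ (Fin 4) | 0 ≤ y 0 * y 2 + y 1 * y 3} =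
      Real.sqrt (a 0 ^ 2 + a 1 ^ 2) ∧
    {x : EuclideanSpace ℝ (Fin 4) | (0 ≤ x 0 * x 2 + x 1 * x 3) ∧
        dist a x = Metric.infDist a {y : EuclideanSpace ℝ (Fin 4) | 0 ≤ y 0 * y 2 + y 1 * y 3}} =
    {x : EuclideanSpace ℝ (Fin 4) |
        (x 2 + a 0 / 2) ^ 2 + (x 3 + a 1 / 2) ^ 2 = (a 0 ^ 2 + a 1 ^ 2) / 4 ∧
        x 0 = a 0 + x 2 ∧ x 1 = a 1 + x 3} := by
  have hr : 0 ≤ a 0 ^ 2 + a 1 ^ 2 := by positivity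
  have hlower : ∀ y : EuclideanSpace ℝ (Fin 4), 0 ≤ y 0 * y 2 + y 1 * y 3 →
      √(a 0 ^ 2 + a 1 ^ 2) ≤ dist a y := by
    intro y hy
    refine Real.sqrt_le_iff.mpr ⟨dist_nonneg, ?_⟩
    rw [dist_sq_antidiagonal a y h2 h3]
    nlinarith [sq_nonneg (y 0 - y 2 - a 0), sq_nonneg (y 1 - y 3 - a 1)]
  have hmem : !₂[a 0, a 1, 0, 0] ∈
      {y : EuclideanSpace ℝ (Fin 4) | 0 ≤ y 0 * y 2 + y 1 * y 3} := by
    simp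
  have hattain : dist a !₂[a 0, a 1, 0, 0] = √(a 0 ^ 2 + a 1 ^ 2) := by
    rw [eq_comm, Real.sqrt_eq_iff_eq_sq hr dist_nonneg, dist_sq_antidiagonal a _ h2 h3]
    simp
  have hdist : Metric.infDist a {y : EuclideanSpace ℝ (Fin 4) | 0 ≤ y 0 * y 2 + y 1 * y 3} =
      √(a 0 ^ 2 + a 1 ^ 2) :=
    le_antisymm (hattain ▸ Metric.infDist_le_dist_of_mem hmem)
      ((Metric.le_infDist ⟨_, hmem⟩).mpr fun {y} hy => hlower y hy)
  refine ⟨hdist, ?_⟩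
  ext x
  simp only [Set.mem_ofPred_eq]
  rw [hdist, eq_comm (a := dist a x), Real.sqrt_eq_iff_eq_sq hr dist_nonneg,
    dist_sq_antidiagonal a x h2 h3]
  constructor
  · rintro ⟨hx, h⟩
    have h0 : x 0 - x 2 - a 0 = 0 := by
      apply pow_eq_zero_iff two_ne_zero |>.mp
      nlinarith [sq_nonneg (x 0 - x 2 - a 0), sq_nonneg (x 1 - x 3 - a 1)]
    have h1 : x 1 - x 3 - a 1 = 0 := by
      apply pow_eq_zero_iff two_ne_zero |>.mp
      nlinarith [sq_nonneg (x 0 - x 2 - a 0), sq_nonneg (x 1 - x 3 - a 1)]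
    have e0 : x 0 = a 0 + x 2 := by linarith
    have e1 : x 1 = a 1 + x 3 := by linarith
    refine ⟨?_, e0, e1⟩
    rw [e0, e1] at h
    linarith
  · rintro ⟨h, e0, e1⟩
    rw [e0, e1]
    constructor <;> linarith
end

section
/- The set of points (a,b) ∈ ℂ² that admit more than one nearest point in the closed set C_H = {(c,d) ∈ ℂ² : Re(c·conj(d)) ≥ 0} (with respect to the Euclidean distance on ℂ² ≅ ℝ⁴) is exactly {(a, −a) : a ∈ ℂ, a ≠ 0}. -/
/-- The closure `C_H = {(c,d) : Re(c·conj d) ≥ 0}` of the Hurwitz stable 1×1 pencils,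
as a subset of `ℂ²` with the Euclidean norm. -/
def CH : Set (EuclideanSpace ℂ (Fin 2)) :=
  {q | 0 ≤ (q 0 * (starRingEnd ℂ) (q 1)).re}

theorem mem_CH_iff (q : EuclideanSpace ℂ (Fin 2)) :
    q ∈ CH ↔ ‖q 0 - q 1‖ ≤ ‖q 0 + q 1‖ := by
  rw [← sq_le_sq₀ (norm_nonneg _) (norm_nonneg _), Complex.sq_norm, Complex.sq_norm,
    Complex.normSq_sub, Complex.normSq_add]
  rw [CH, Set.mem_ofPred_eq]
  constructor <;> intro h <;> linarith

theorem two_mul_dist_sq (p q : EuclideanSpace ℂ (Fin 2)) :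
    2 * dist p q ^ 2 =
      ‖(q 0 + q 1) - (p 0 + p 1)‖ ^ 2 + ‖(q 0 - q 1) - (p 0 - p 1)‖ ^ 2 := by
  rw [EuclideanSpace.dist_eq, Real.sq_sqrt (by positivity), Fin.sum_univ_two]
  simp only [dist_eq_norm, Complex.sq_norm, Complex.normSq_apply, Complex.sub_re, Complex.sub_im,
    Complex.add_re, Complex.add_im]
  ring

/-- The lower bound `(‖t‖ - ‖s‖)² / 2` for the squared distance from `(s, t)` to the cone
`‖v‖ ≤ ‖u‖` is attained at one point only when `0 < ‖s‖ ≤ ‖t‖`. -/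
theorem smul_eq_smul_of_norm_sub_sq_le {E : Type*} [NormedAddCommGroup E] [InnerProductSpace ℝ E]
    {s t u v : E} (hs : 0 < ‖s‖) (hst : ‖s‖ ≤ ‖t‖) (huv : ‖v‖ ≤ ‖u‖)
    (h : ‖u - s‖ ^ 2 + ‖v - t‖ ^ 2 ≤ (‖t‖ - ‖s‖) ^ 2 / 2) :
    (2 * ‖s‖) • u = (‖s‖ + ‖t‖) • s ∧ (2 * ‖t‖) • v = (‖s‖ + ‖t‖) • t := by
  have ht : 0 < ‖t‖ := hs.trans_le hst
  have key : ‖t‖ * ‖(2 * ‖s‖) • u - (‖s‖ + ‖t‖) • s‖ ^ 2 +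
      ‖s‖ * ‖(2 * ‖t‖) • v - (‖s‖ + ‖t‖) • t‖ ^ 2 =
      2 * (‖s‖ * ‖t‖) * ((‖s‖ + ‖t‖) *
        (‖u - s‖ ^ 2 + ‖v - t‖ ^ 2 - (‖t‖ - ‖s‖) ^ 2 / 2) +
        (‖t‖ - ‖s‖) * (‖v‖ ^ 2 - ‖u‖ ^ 2)) := by
    simp only [norm_sub_sq_real, norm_smul, real_inner_smul_left, real_inner_smul_right, mul_pow,
      Real.norm_eq_abs, sq_abs]
    ring
  have hle : (‖s‖ + ‖t‖) * (‖u - s‖ ^ 2 + ‖v - t‖ ^ 2 - (‖t‖ - ‖s‖) ^ 2 / 2) +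
      (‖t‖ - ‖s‖) * (‖v‖ ^ 2 - ‖u‖ ^ 2) ≤ 0 := by
    have h₁ := mul_nonpos_of_nonneg_of_nonpos (add_pos hs ht).le (sub_nonpos.2 h)
    have h₂ := mul_nonpos_of_nonneg_of_nonpos (sub_nonneg.2 hst)
      (sub_nonpos.2 (pow_le_pow_left₀ (norm_nonneg v) huv 2))
    linarith
  have hsum := key.le.trans (mul_nonpos_of_nonneg_of_nonpos (by positivity) hle)
  have hu : 0 ≤ ‖t‖ * ‖(2 * ‖s‖) • u - (‖s‖ + ‖t‖) • s‖ ^ 2 := by positivity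
  have hv : 0 ≤ ‖s‖ * ‖(2 * ‖t‖) • v - (‖s‖ + ‖t‖) • t‖ ^ 2 := by positivity
  have hu0 := le_antisymm (by linarith) hu
  have hv0 := le_antisymm (by linarith) hv
  simp only [hs.ne', ht.ne', false_or, mul_eq_zero, sq_eq_zero_iff, norm_eq_zero,
    sub_eq_zero] at hu0 hv0
  exact ⟨hu0, hv0⟩

theorem exists_mem_CH_two_mul_dist_sq_eq (p : EuclideanSpace ℂ (Fin 2)) (hs : p 0 + p 1 ≠ 0)
    (ht : p 0 - p 1 ≠ 0) :
    ∃ r ∈ CH, 2 * dist p r ^ 2 = (‖p 0 - p 1‖ - ‖p 0 + p 1‖) ^ 2 / 2 := by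
  set s := p 0 + p 1 with hs_def
  set t := p 0 - p 1 with ht_def
  have hs' : ‖s‖ ≠ 0 := norm_ne_zero_iff.2 hs
  have ht' : ‖t‖ ≠ 0 := norm_ne_zero_iff.2 ht
  set k : ℝ := (‖s‖ + ‖t‖) / (2 * ‖s‖) with hk
  set l : ℝ := (‖s‖ + ‖t‖) / (2 * ‖t‖) with hl
  have hadd : (k • s + l • t) / 2 + (k • s - l • t) / 2 = k • s := by ring
  have hsub : (k • s + l • t) / 2 - (k • s - l • t) / 2 = l • t := by ring
  refine ⟨!₂[(k • s + l • t) / 2, (k • s - l • t) / 2], ?_, ?_⟩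
  · rw [mem_CH_iff]
    simp only [Matrix.cons_val_zero, Matrix.cons_val_one, hadd, hsub, norm_smul,
      Real.norm_eq_abs]
    rw [abs_of_nonneg (by positivity), abs_of_nonneg (by positivity), hk, hl]
    apply le_of_eq
    field_simp
  · rw [two_mul_dist_sq]
    simp only [Matrix.cons_val_zero, Matrix.cons_val_one, hadd, hsub,
      ← hs_def, ← ht_def]
    have hks : k • s - s = (k - 1) • s := by rw [sub_smul, one_smul]
    have hlt : l • t - t = (l - 1) • t := by rw [sub_smul, one_smul]
    rw [hks, hlt, norm_smul, norm_smul, mul_pow, mul_pow, Real.norm_eq_abs, Real.norm_eq_abs,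
      sq_abs, sq_abs, hk, hl]
    field_simp
    ring

theorem nearest_point_unique {p q₁ q₂ : EuclideanSpace ℂ (Fin 2)} (hs : p 0 + p 1 ≠ 0)
    (hp : p ∉ CH) (hq₁ : q₁ ∈ CH) (hq₂ : q₂ ∈ CH) (h₁ : ∀ r ∈ CH, dist p q₁ ≤ dist p r)
    (h₂ : ∀ r ∈ CH, dist p q₂ ≤ dist p r) : q₁ = q₂ := by
  have hs' : 0 < ‖p 0 + p 1‖ := norm_pos_iff.2 hs
  rw [mem_CH_iff, not_le] at hp
  have ht' : 0 < ‖p 0 - p 1‖ := hs'.trans hp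
  obtain ⟨r, hr, hpr⟩ := exists_mem_CH_two_mul_dist_sq_eq p hs (norm_pos_iff.1 ht')
  have key (q : EuclideanSpace ℂ (Fin 2)) (hq : q ∈ CH) (h : dist p q ≤ dist p r) :=
    smul_eq_smul_of_norm_sub_sq_le hs' hp.le ((mem_CH_iff q).1 hq) <| by
      rw [← two_mul_dist_sq, ← hpr]
      gcongr
  obtain ⟨hu₁, hv₁⟩ := key q₁ hq₁ (h₁ r hr)
  obtain ⟨hu₂, hv₂⟩ := key q₂ hq₂ (h₂ r hr)
  have hu := smul_right_injective ℂ (by positivity : 2 * ‖p 0 + p 1‖ ≠ 0) (hu₁.trans hu₂.symm)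
  have hv := smul_right_injective ℂ (by positivity : 2 * ‖p 0 - p 1‖ ≠ 0) (hv₁.trans hv₂.symm)
  ext i
  fin_cases i
  · change q₁ 0 = q₂ 0
    linear_combination (hu + hv) / 2
  · change q₁ 1 = q₂ 1
    linear_combination (hu - hv) / 2

theorem norm_le_dist_of_mem_CH {p r : EuclideanSpace ℂ (Fin 2)} (hp : p 1 = -(p 0))
    (hr : r ∈ CH) : ‖p 0‖ ≤ dist p r := by
  rw [mem_CH_iff] at hr
  have hd := two_mul_dist_sq p r
  have ht : p 0 - p 1 = 2 * p 0 := by rw [hp]; ring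
  rw [hp, add_neg_cancel, sub_zero, ← hp, ht] at hd
  have htri : 2 * ‖p 0‖ ≤ ‖r 0 + r 1‖ + ‖r 0 - r 1 - 2 * p 0‖ := by
    have h := norm_sub_norm_le (2 * p 0) (r 0 - r 1)
    rw [norm_sub_rev (2 * p 0), norm_mul, Complex.norm_ofNat] at h
    linarith
  have hsq := pow_le_pow_left₀ (by positivity) htri 2
  refine le_of_sq_le_sq ?_ dist_nonneg
  linarith [add_sq_le (a := ‖r 0 + r 1‖) (b := ‖r 0 - r 1 - 2 * p 0‖)]

/-- the medial axis of `C_H`, i.e. the set of points of `ℂ²` admitting more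
than one nearest point in `C_H`, is exactly `{(a, −a) : a ≠ 0}`. -/
theorem hurwitz_medial_axis :
    {p : EuclideanSpace ℂ (Fin 2) | ∃ q₁ q₂ : EuclideanSpace ℂ (Fin 2),
        q₁ ∈ CH ∧ q₂ ∈ CH ∧ q₁ ≠ q₂ ∧
        (∀ r ∈ CH, dist p q₁ ≤ dist p r) ∧ (∀ r ∈ CH, dist p q₂ ≤ dist p r)} =
    {p : EuclideanSpace ℂ (Fin 2) | p 1 = -(p 0) ∧ p 0 ≠ 0} := by
  ext p
  simp only [Set.mem_ofPred_eq]
  constructor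
  · rintro ⟨q₁, q₂, hq₁, hq₂, hne, h₁, h₂⟩
    have hp : p ∉ CH := fun hp ↦ hne <| by
      rw [← dist_le_zero.1 ((h₁ p hp).trans_eq (dist_self p)),
        ← dist_le_zero.1 ((h₂ p hp).trans_eq (dist_self p))]
    refine ⟨?_, fun h0 ↦ hp (by simp [CH, h0])⟩
    by_contra hs
    exact hne (nearest_point_unique (fun h ↦ hs (eq_neg_of_add_eq_zero_right h)) hp hq₁ hq₂ h₁ h₂)
  · rintro ⟨hp, h0⟩
    have hd₁ : dist p !₂[p 0, 0] = ‖p 0‖ := by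
      simp [EuclideanSpace.dist_eq, hp]
    have hd₂ : dist p !₂[0, p 1] = ‖p 0‖ := by
      simp [EuclideanSpace.dist_eq]
    refine ⟨!₂[p 0, 0], !₂[0, p 1], by simp [CH], by simp [CH], fun h ↦ h0 ?_,
      fun r hr ↦ hd₁.trans_le (norm_le_dist_of_mem_CH hp hr),
      fun r hr ↦ hd₂.trans_le (norm_le_dist_of_mem_CH hp hr)⟩
    simpa using congrArg (fun q : EuclideanSpace ℂ (Fin 2) ↦ q 0) h
end

section
/- Let C_S = {(c,d) ∈ ℂ² : |c| ≤ |d|} and let (a,b) ∈ ℂ² with |a| > |b| and b ≠ 0. Then the point p = ( ((|a|+|b|)/(2|a|))·a , ((|a|+|b|)/(2|b|))·b ) belongs to C_S, it is the unique nearest point of (a,b) in C_S, and the distance from (a,b) to C_S equals (|a| − |b|)/√2. -/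
/-- The closure `C_S = {(c,d) : |c| ≤ |d|}` of the Schur stable 1×1 pencils, as a subset
of `ℂ²` with the Euclidean norm. -/
def CS : Set (EuclideanSpace ℂ (Fin 2)) := {q | ‖q 0‖ ≤ ‖q 1‖}

/-- If the reverse triangle inequality is an equality for `z` and `w`, then `w` is the nonnegative
multiple of `z` determined by its norm. -/
lemma eq_ofReal_mul_of_sq_norm_sub_le {z w : ℂ} (hz : z ≠ 0)
    (h : ‖z - w‖ ^ 2 ≤ (‖z‖ - ‖w‖) ^ 2) : w = ((‖w‖ / ‖z‖ : ℝ) : ℂ) * z := by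
  have hle : ‖z - w‖ ≤ |‖z‖ - ‖w‖| := by
    simpa using sq_le_sq.mp h
  have hray : SameRay ℝ z w :=
    sameRay_iff_norm_sub.mpr (le_antisymm hle (abs_norm_sub_norm_le z w))
  have hsmul := hray.norm_smul_eq
  simp only [Complex.real_smul] at hsmul
  have hz' : (‖z‖ : ℂ) ≠ 0 := by simpa using hz
  push_cast
  field_simp
  linear_combination hsmul

lemma sq_norm_sub_norm_le (z w : ℂ) : (‖z‖ - ‖w‖) ^ 2 ≤ ‖z - w‖ ^ 2 :=
  sq_le_sq.mpr (by simpa using abs_norm_sub_norm_le z w)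

lemma norm_sub_ofReal_mul_self (z : ℂ) (t : ℝ) : ‖z - (t : ℂ) * z‖ ^ 2 = ((1 - t) * ‖z‖) ^ 2 := by
  have h : z - (t : ℂ) * z = ((1 - t : ℝ) : ℂ) * z := by push_cast; ring
  rw [h, norm_mul, Complex.norm_real, mul_pow, mul_pow, Real.norm_eq_abs, sq_abs]

/-- for `|a| > |b|`, `b ≠ 0`, the point
`p = (((|a|+|b|)/(2|a|))·a, ((|a|+|b|)/(2|b|))·b)` is the unique nearest point of
`(a,b)` in `C_S`, and the distance from `(a,b)` to `C_S` is `(|a| − |b|)/√2`. -/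
theorem schur_projection (a b : ℂ) (hab : ‖b‖ < ‖a‖) (hb : b ≠ 0)
    (x p : EuclideanSpace ℂ (Fin 2))
    (hx0 : x 0 = a) (hx1 : x 1 = b)
    (hp0 : p 0 = (((‖a‖ + ‖b‖) / (2 * ‖a‖) : ℝ) : ℂ) * a)
    (hp1 : p 1 = (((‖a‖ + ‖b‖) / (2 * ‖b‖) : ℝ) : ℂ) * b) :
    p ∈ CS ∧ (∀ q ∈ CS, dist x p ≤ dist x q) ∧
    (∀ q ∈ CS, dist x q = dist x p → q = p) ∧
    Metric.infDist x CS = (‖a‖ - ‖b‖) / Real.sqrt 2 := by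
  have hB : 0 < ‖b‖ := norm_pos_iff.mpr hb
  have hA : 0 < ‖a‖ := hB.trans hab
  have ha : a ≠ 0 := norm_pos_iff.mp hA
  have hsq (q : EuclideanSpace ℂ (Fin 2)) : dist x q ^ 2 = ‖a - q 0‖ ^ 2 + ‖b - q 1‖ ^ 2 := by
    rw [EuclideanSpace.dist_sq_eq, Fin.sum_univ_two, hx0, hx1, dist_eq_norm, dist_eq_norm]
  have hpsq : dist x p ^ 2 = (‖a‖ - ‖b‖) ^ 2 / 2 := by
    rw [hsq, hp0, hp1, norm_sub_ofReal_mul_self, norm_sub_ofReal_mul_self]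
    field_simp
    ring
  have hpmem : p ∈ CS := by
    change ‖p 0‖ ≤ ‖p 1‖
    rw [hp0, hp1, norm_mul, norm_mul, Complex.norm_real, Complex.norm_real,
      Real.norm_of_nonneg (by positivity), Real.norm_of_nonneg (by positivity)]
    apply le_of_eq
    field_simp
  have hmin : ∀ q ∈ CS, dist x p ≤ dist x q := by
    intro q hq
    have hq' : ‖q 0‖ ≤ ‖q 1‖ := hq
    refine (sq_le_sq₀ dist_nonneg dist_nonneg).mp ?_
    rw [hpsq, hsq]
    have h0 := sq_norm_sub_norm_le a (q 0)
    have h1 := sq_norm_sub_norm_le b (q 1)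
    nlinarith [sq_nonneg (‖a‖ - ‖q 0‖ + ‖b‖ - ‖q 1‖), sq_nonneg (‖q 1‖ - ‖q 0‖),
      mul_nonneg (sub_nonneg.mpr hab.le) (sub_nonneg.mpr hq')]
  refine ⟨hpmem, hmin, ?_, ?_⟩
  · intro q hq hqp
    have hq' : ‖q 0‖ ≤ ‖q 1‖ := hq
    have heq : ‖a - q 0‖ ^ 2 + ‖b - q 1‖ ^ 2 = (‖a‖ - ‖b‖) ^ 2 / 2 := by
      rw [← hsq, hqp, hpsq]
    have h0 := sq_norm_sub_norm_le a (q 0)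
    have h1 := sq_norm_sub_norm_le b (q 1)
    have hprod := mul_nonneg (sub_nonneg.mpr hab.le) (sub_nonneg.mpr hq')
    have hsum : ‖a‖ - ‖q 0‖ + ‖b‖ - ‖q 1‖ = 0 := by
      apply pow_eq_zero_iff two_ne_zero |>.mp
      nlinarith [sq_nonneg (‖a‖ - ‖q 0‖ + ‖b‖ - ‖q 1‖), sq_nonneg (‖q 1‖ - ‖q 0‖)]
    have hdiff : ‖q 1‖ - ‖q 0‖ = 0 := by
      apply pow_eq_zero_iff two_ne_zero |>.mp
      nlinarith [sq_nonneg (‖a‖ - ‖q 0‖ + ‖b‖ - ‖q 1‖), sq_nonneg (‖q 1‖ - ‖q 0‖)]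
    have hn0 : ‖q 0‖ = (‖a‖ + ‖b‖) / 2 := by linarith
    have hn1 : ‖q 1‖ = (‖a‖ + ‖b‖) / 2 := by linarith
    have e0 := eq_ofReal_mul_of_sq_norm_sub_le (w := q 0) ha
      (by rw [hn0]; rw [hn0] at h0; rw [hn1] at h1; nlinarith)
    have e1 := eq_ofReal_mul_of_sq_norm_sub_le (w := q 1) hb
      (by rw [hn1]; rw [hn0] at h0; rw [hn1] at h1; nlinarith)
    rw [hn0, div_div] at e0
    rw [hn1, div_div] at e1
    ext i
    fin_cases i
    · exact e0.trans hp0.symm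
    · exact e1.trans hp1.symm
  · have hdist : dist x p = (‖a‖ - ‖b‖) / Real.sqrt 2 := by
      refine (sq_eq_sq₀ dist_nonneg (div_nonneg (sub_nonneg.mpr hab.le) (Real.sqrt_nonneg 2))).mp ?_
      rw [hpsq, div_pow, Real.sq_sqrt zero_le_two]
    rw [← hdist]
    exact le_antisymm (Metric.infDist_le_dist_of_mem hpmem)
      ((Metric.le_infDist ⟨p, hpmem⟩).mpr fun {q} hq => hmin q hq)
end

section
/- Let C_S = {(c,d) ∈ ℂ² : |c| ≤ |d|} and let a ∈ ℂ with a ≠ 0. Then the distance from (a,0) to C_S equals |a|/√2, and the set of nearest points of (a,0) in C_S is exactly { (a/2, d) : d ∈ ℂ, |d| = |a|/2 }. -/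
/-- The squared distance from `(x 0, 0)` to `q`, split into its minimal value over `CS` and two
remainders that are nonnegative on `CS`. -/
lemma dist_sq_eq_of_snd_eq_zero (x q : EuclideanSpace ℂ (Fin 2)) (hx1 : x 1 = 0) :
    dist x q ^ 2 = ‖x 0‖ ^ 2 / 2 + 2 * ‖q 0 - x 0 / 2‖ ^ 2 + (‖q 1‖ ^ 2 - ‖q 0‖ ^ 2) := by
  rw [EuclideanSpace.dist_eq, Real.sq_sqrt (by positivity), Fin.sum_univ_two, hx1, dist_zero_left,
    dist_eq_norm]
  have hhalf : ‖x 0‖ = 2 * ‖x 0 / 2‖ := by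
    rw [norm_div, RCLike.norm_ofNat]
    ring
  have hpar := parallelogram_law_with_norm ℝ (x 0 / 2) (q 0 - x 0 / 2)
  rw [add_sub_cancel, show x 0 / 2 - (q 0 - x 0 / 2) = x 0 - q 0 by ring] at hpar
  rw [hhalf]
  linarith

/-- for `a ≠ 0`, the distance from `(a,0)` to `C_S` is `|a|/√2`, and the
nearest points of `(a,0)` in `C_S` are exactly the points `(a/2, d)` with `|d| = |a|/2`. -/
theorem schur_projection_medial (a : ℂ) (ha : a ≠ 0) (x : EuclideanSpace ℂ (Fin 2))
    (hx0 : x 0 = a) (hx1 : x 1 = 0) :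
    Metric.infDist x CS = ‖a‖ / Real.sqrt 2 ∧
    {q : EuclideanSpace ℂ (Fin 2) | q ∈ CS ∧ dist x q = Metric.infDist x CS} =
      {q : EuclideanSpace ℂ (Fin 2) | q 0 = a / 2 ∧ ‖q 1‖ = ‖a‖ / 2} := by
  have key (q : EuclideanSpace ℂ (Fin 2)) := dist_sq_eq_of_snd_eq_zero x q hx1
  simp only [hx0] at key
  have hr : (‖a‖ / Real.sqrt 2) ^ 2 = ‖a‖ ^ 2 / 2 := by
    rw [div_pow, Real.sq_sqrt zero_le_two]
  have hr0 : 0 ≤ ‖a‖ / Real.sqrt 2 := by positivity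
  have hhalf : ‖a / 2‖ = ‖a‖ / 2 := by rw [norm_div, RCLike.norm_ofNat]
  have lower (q : EuclideanSpace ℂ (Fin 2)) (hq : q ∈ CS) : ‖a‖ / Real.sqrt 2 ≤ dist x q := by
    have hq' : ‖q 0‖ ^ 2 ≤ ‖q 1‖ ^ 2 := pow_le_pow_left₀ (norm_nonneg _) hq 2
    refine (sq_le_sq₀ hr0 dist_nonneg).1 ?_
    rw [hr, key q]
    linarith [sq_nonneg ‖q 0 - a / 2‖]
  have attained (q : EuclideanSpace ℂ (Fin 2)) (h0 : q 0 = a / 2) (h1 : ‖q 1‖ = ‖a‖ / 2) :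
      q ∈ CS ∧ dist x q = ‖a‖ / Real.sqrt 2 := by
    refine ⟨show ‖q 0‖ ≤ ‖q 1‖ by rw [h0, h1, hhalf], ?_⟩
    rw [← sq_eq_sq₀ dist_nonneg hr0, hr, key q, h0, h1, hhalf, sub_self, norm_zero]
    ring
  have hinf : Metric.infDist x CS = ‖a‖ / Real.sqrt 2 := by
    obtain ⟨hp, hd⟩ := attained !₂[a / 2, a / 2] rfl hhalf
    exact le_antisymm (hd ▸ Metric.infDist_le_dist_of_mem hp)
      ((Metric.le_infDist ⟨_, hp⟩).2 fun {q} hq => lower q hq)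
  refine ⟨hinf, ?_⟩
  ext q
  simp only [Set.mem_ofPred_eq, hinf]
  refine ⟨fun ⟨hq, hd⟩ => ?_, fun ⟨h0, h1⟩ => attained q h0 h1⟩
  have hq' : ‖q 0‖ ^ 2 ≤ ‖q 1‖ ^ 2 := pow_le_pow_left₀ (norm_nonneg _) hq 2
  have hk := key q
  rw [hd, hr] at hk
  have hz : ‖q 0 - a / 2‖ ^ 2 = 0 := by linarith [sq_nonneg ‖q 0 - a / 2‖]
  have h0 : q 0 = a / 2 := by rwa [sq_eq_zero_iff, norm_eq_zero, sub_eq_zero] at hz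
  refine ⟨h0, ?_⟩
  rw [← hhalf, ← h0, ← sq_eq_sq₀ (norm_nonneg _) (norm_nonneg _)]
  linarith
end

section
/- Let C be a nonempty closed subset of a finite-dimensional real inner product space E, and let g(x) = (dist(x,C))² be the squared distance function. Then: (i) if x ∈ E has a unique nearest point y ∈ C (i.e. y is the unique point of C with ‖x − y‖ = dist(x,C)), then g is Fréchet differentiable at x with derivative v ↦ 2⟨x − y, v⟩; (ii) if x has more than one nearest point in C, then g is not differentiable at x; (iii) g is differentiable Lebesgue-almost everywhere on E, i.e. the medial axis of C has measure zero. -/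
open MeasureTheory

/-- Points of a closed set that are nearly nearest to `x` are close to the nearest point of `x`,
when the latter is unique. -/
theorem exists_pos_forall_dist_lt_of_unique_nearest {X : Type*} [MetricSpace X] [ProperSpace X]
    {C : Set X} {x y : X} (hC : IsClosed C)
    (huniq : ∀ y' ∈ C, dist x y' = Metric.infDist x C → y' = y) {ε : ℝ} (hε : 0 < ε) :
    ∃ δ > 0, ∀ p ∈ C, dist x p < Metric.infDist x C + δ → dist p y < ε := by
  have hK : IsCompact (C ∩ Metric.closedBall x (Metric.infDist x C + 1) ∩ (Metric.ball y ε)ᶜ) :=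
    ((isCompact_closedBall _ _).inter_left hC).inter_right Metric.isOpen_ball.isClosed_compl
  rcases (C ∩ Metric.closedBall x (Metric.infDist x C + 1) ∩
      (Metric.ball y ε)ᶜ).eq_empty_or_nonempty with h | h
  · refine ⟨1, one_pos, fun p hp hxp => ?_⟩
    by_contra hpy
    have : p ∈ C ∩ Metric.closedBall x (Metric.infDist x C + 1) ∩ (Metric.ball y ε)ᶜ :=
      ⟨⟨hp, by rw [Metric.mem_closedBall, dist_comm]; exact hxp.le⟩, hpy⟩
    rw [h] at this
    exact this
  · obtain ⟨q, ⟨⟨hqC, -⟩, hqy⟩, hmin⟩ :=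
      hK.exists_isMinOn h (continuous_const.dist continuous_id).continuousOn (f := dist x)
    have hlt : Metric.infDist x C < dist x q := by
      refine (Metric.infDist_le_dist_of_mem hqC).lt_of_ne fun heq => hqy ?_
      rw [huniq q hqC heq.symm]
      exact Metric.mem_ball_self hε
    refine ⟨min 1 (dist x q - Metric.infDist x C), lt_min one_pos (sub_pos.2 hlt),
      fun p hp hxp => ?_⟩
    have h₁ := min_le_left 1 (dist x q - Metric.infDist x C)
    have h₂ := min_le_right 1 (dist x q - Metric.infDist x C)
    by_contra hpy
    have : dist x q ≤ dist x p :=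
      hmin ⟨⟨hp, by rw [Metric.mem_closedBall, dist_comm]; linarith⟩, hpy⟩
    linarith

theorem infDist_sq_le_norm_sub_sq {E : Type*} [SeminormedAddCommGroup E] {C : Set E} {y : E}
    (hy : y ∈ C) (z : E) : Metric.infDist z C ^ 2 ≤ ‖z - y‖ ^ 2 := by
  rw [← dist_eq_norm]
  exact pow_le_pow_left₀ Metric.infDist_nonneg (Metric.infDist_le_dist_of_mem hy) 2

section

variable {E : Type*} [NormedAddCommGroup E] [InnerProductSpace ℝ E] {C : Set E} {x y : E}

theorem hasFDerivAt_norm_sub_const_sq (x y : E) :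
    HasFDerivAt (fun z => ‖z - y‖ ^ 2) ((2 : ℝ) • innerSL ℝ (x - y)) x := by
  refine ((hasFDerivAt_id x).sub_const y).norm_sq.congr_fderiv ?_
  ext v
  simp [two_mul]

/-- At a point of differentiability, the derivative of the squared distance function is determined
by any nearest point. -/
theorem HasFDerivAt.infDist_sq_eq {L : E →L[ℝ] ℝ}
    (hL : HasFDerivAt (fun z => Metric.infDist z C ^ 2) L x) (hy : y ∈ C)
    (hxy : dist x y = Metric.infDist x C) : L = (2 : ℝ) • innerSL ℝ (x - y) := by
  have hmin : IsLocalMin (fun z => ‖z - y‖ ^ 2 - Metric.infDist z C ^ 2) x := by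
    refine Filter.Eventually.of_forall fun z => ?_
    simp only [← hxy, dist_eq_norm, sub_self]
    exact sub_nonneg.2 (infDist_sq_le_norm_sub_sq hy z)
  exact (sub_eq_zero.1 (hmin.hasFDerivAt_eq_zero ((hasFDerivAt_norm_sub_const_sq x y).sub hL))).symm

/-- The squared distance function to a closed set is differentiable at every point with a unique
nearest point. -/
theorem hasFDerivAt_infDist_sq_of_unique_nearest [ProperSpace E] (hC : IsClosed C) (hy : y ∈ C)
    (hxy : dist x y = Metric.infDist x C)
    (huniq : ∀ y' ∈ C, dist x y' = Metric.infDist x C → y' = y) :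
    HasFDerivAt (fun z => Metric.infDist z C ^ 2) ((2 : ℝ) • innerSL ℝ (x - y)) x := by
  rw [hasFDerivAt_iff_isLittleO, Asymptotics.isLittleO_iff]
  intro c hc
  obtain ⟨δ, hδ, hnear⟩ :=
    exists_pos_forall_dist_lt_of_unique_nearest hC huniq (ε := c / 2) (by positivity)
  filter_upwards [Metric.ball_mem_nhds x (lt_min hc (half_pos hδ))] with z hz
  rw [Metric.mem_ball, lt_min_iff] at hz
  obtain ⟨p, hp, hzp⟩ := hC.exists_infDist_eq_dist ⟨y, hy⟩ z
  have hpy : ‖p - y‖ < c / 2 := by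
    rw [← dist_eq_norm]
    refine hnear p hp ?_
    have h₁ := dist_triangle_left x p z
    have h₂ := Metric.infDist_le_infDist_add_dist (s := C) (x := z) (y := x)
    linarith [hz.2]
  have hzx : ‖z - x‖ < c := by
    rw [← dist_eq_norm]
    exact hz.1
  have hexp : ∀ q, ‖z - q‖ ^ 2 = ‖x - q‖ ^ 2 + 2 * inner ℝ (x - q) (z - x) + ‖z - x‖ ^ 2 := by
    intro q
    rw [← norm_add_sq_real, add_comm, sub_add_sub_cancel]
  have hupper := infDist_sq_le_norm_sub_sq hy z
  have hxp := infDist_sq_le_norm_sub_sq hp x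
  have hinner : inner ℝ (x - p) (z - x) = inner ℝ (x - y) (z - x) - inner ℝ (p - y) (z - x) := by
    rw [← inner_sub_left, sub_sub_sub_cancel_right]
  have hcs := real_inner_le_norm (p - y) (z - x)
  have hmul : ‖p - y‖ * ‖z - x‖ ≤ c / 2 * ‖z - x‖ := by gcongr
  have hsq : ‖z - x‖ ^ 2 ≤ c * ‖z - x‖ := by
    rw [sq]
    gcongr
  have hgz : Metric.infDist z C ^ 2 = ‖z - p‖ ^ 2 := by rw [hzp, dist_eq_norm]
  have hgx : Metric.infDist x C ^ 2 = ‖x - y‖ ^ 2 := by rw [← hxy, dist_eq_norm]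
  rw [hexp] at hupper hgz
  simp only [smul_apply, innerSL_apply_apply, smul_eq_mul, Real.norm_eq_abs]
  rw [abs_le]
  constructor
  · nlinarith [sq_nonneg ‖z - x‖]
  · linarith

theorem ae_differentiableAt_infDist_sq [FiniteDimensional ℝ E] [MeasurableSpace E] [BorelSpace E]
    (μ : Measure E) [μ.IsAddHaarMeasure] (C : Set E) :
    ∀ᵐ x ∂μ, DifferentiableAt ℝ (fun z => Metric.infDist z C ^ 2) x := by
  filter_upwards [(Metric.lipschitz_infDist_pt C).ae_differentiableAt (μ := μ)] with x hx
  exact hx.pow 2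

end

/-- for a nonempty closed set `C` in a finite-dimensional real inner product
space, the squared distance function `g(x) = dist(x,C)²` is (i) Fréchet differentiable,
with derivative `v ↦ 2⟨x − y, v⟩`, at every point `x` having a unique nearest point `y` in
`C`; (ii) not differentiable at points with more than one nearest point; (iii)
differentiable Lebesgue-almost everywhere (the medial axis of `C` has measure zero). -/
theorem sq_dist_differentiability {E : Type*} [NormedAddCommGroup E]
    [InnerProductSpace ℝ E] [FiniteDimensional ℝ E] [MeasurableSpace E] [BorelSpace E]
    (C : Set E) (hC : IsClosed C) (hne : C.Nonempty) :
    (∀ x y : E, y ∈ C → dist x y = Metric.infDist x C →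
      (∀ y' ∈ C, dist x y' = Metric.infDist x C → y' = y) →
      HasFDerivAt (fun z => Metric.infDist z C ^ 2) ((2 : ℝ) • innerSL ℝ (x - y)) x) ∧
    (∀ x y₁ y₂ : E, y₁ ∈ C → y₂ ∈ C → y₁ ≠ y₂ →
      dist x y₁ = Metric.infDist x C → dist x y₂ = Metric.infDist x C →
      ¬ DifferentiableAt ℝ (fun z => Metric.infDist z C ^ 2) x) ∧
    (∀ᵐ x ∂(volume : Measure E), DifferentiableAt ℝ (fun z => Metric.infDist z C ^ 2) x) := by
  refine ⟨fun x y hy hxy huniq => hasFDerivAt_infDist_sq_of_unique_nearest hC hy hxy huniq, ?_,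
    ae_differentiableAt_infDist_sq volume C⟩
  rintro x y₁ y₂ hy₁ hy₂ hne₁₂ hxy₁ hxy₂ ⟨L, hL⟩
  have h := (hL.infDist_sq_eq hy₁ hxy₁).symm.trans (hL.infDist_sq_eq hy₂ hxy₂)
  have h' := smul_right_injective _ (two_ne_zero (α := ℝ)) h
  exact hne₁₂ (sub_right_injective (innerSL_inj.1 h'))
end

section
/- Let Ω be a nonempty closed subset of the Riemann sphere ℂ ∪ {∞}, and let (A,B) be an upper triangular n×n pencil in the closure of S_tri(Ω,n) that has exactly one index i with (A_{ii}, B_{ii}) = (0,0) (so the pencil is singular). Then every eigenvalue of (A,B) belongs to Ω; i.e., every x₀ ∈ ℂ with rank(A + x₀B) < sup_{x ∈ ℂ} rank(A + xB) satisfies x₀ ∈ Ω, and if rank(B + 0·A) < sup_{x ∈ ℂ} rank(B + xA) then ∞ ∈ Ω. -/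
open Matrix

open Filter Topology in
/-- A nonzero pair in the closure of `SOmega1 Ω` belongs to `SOmega1 Ω`, for closed `Ω`. -/
theorem mem_SOmega1_of_mem_closure {Ω : Set (OnePoint ℂ)} (hΩ : IsClosed Ω) {p : ℂ × ℂ}
    (hp : p ∈ closure (SOmega1 Ω)) (hp0 : p ≠ 0) : p ∈ SOmega1 Ω := by
  have : (𝓝[SOmega1 Ω] p).NeBot := mem_closure_iff_nhdsWithin_neBot.1 hp
  have h1 : Tendsto Prod.fst (𝓝[SOmega1 Ω] p) (𝓝 p.1) :=
    continuous_fst.continuousAt.mono_left nhdsWithin_le_nhds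
  have h2 : Tendsto Prod.snd (𝓝[SOmega1 Ω] p) (𝓝 p.2) :=
    continuous_snd.continuousAt.mono_left nhdsWithin_le_nhds
  refine ⟨hp0, fun hb => ?_, fun hb => ?_⟩
  · refine hΩ.mem_of_tendsto
      ((OnePoint.continuous_coe.tendsto _).comp (h1.neg.div h2 hb)) ?_
    filter_upwards [self_mem_nhdsWithin, h2.eventually_ne hb] with q hq hq2 using hq.2.1 hq2
  · by_contra hinf
    have ha : p.1 ≠ 0 := fun ha => hp0 (Prod.ext ha hb)
    have hne : ∀ᶠ q in 𝓝[SOmega1 Ω] p, q.2 ≠ 0 := by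
      filter_upwards [self_mem_nhdsWithin] with q hq hq2 using hinf (hq.2.2 hq2)
    have hinv : Tendsto (fun q : ℂ × ℂ => q.2 / -q.1) (𝓝[SOmega1 Ω] p) (𝓝[≠] 0) := by
      refine tendsto_nhdsWithin_iff.2 ⟨?_, ?_⟩
      · have hdiv := h2.div h1.neg (neg_ne_zero.2 ha)
        rwa [hb, zero_div] at hdiv
      · filter_upwards [hne, h1.eventually_ne ha] with q hq2 hq1
        exact div_ne_zero hq2 (neg_ne_zero.2 hq1)
    have hcob : Tendsto (fun q : ℂ × ℂ => -q.1 / q.2) (𝓝[SOmega1 Ω] p) (cocompact ℂ) := by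
      rw [← Metric.cobounded_eq_cocompact]
      refine (tendsto_inv₀_nhdsNE_zero.comp hinv).congr fun q => ?_
      simp
    have hcoe : Tendsto ((↑) : ℂ → OnePoint ℂ) (cocompact ℂ) (𝓝 OnePoint.infty) := by
      rw [← coclosedCompact_eq_cocompact]
      exact OnePoint.tendsto_coe_infty
    refine hinf (hΩ.mem_of_tendsto (hcoe.comp hcob) ?_)
    filter_upwards [self_mem_nhdsWithin, hne] with q hq hq2 using hq.2.1 hq2

open Polynomial in
/-- The diagonal pairs of a pencil in `Stri Ω n` belong to `SOmega1 Ω`. -/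
theorem diag_mem_SOmega1_of_mem_Stri {n : ℕ} {Ω : Set (OnePoint ℂ)}
    {P : Matrix (Fin n) (Fin n) ℂ × Matrix (Fin n) (Fin n) ℂ} (hP : P ∈ Stri Ω n) (j : Fin n) :
    (P.1 j j, P.2 j j) ∈ SOmega1 Ω := by
  obtain ⟨⟨hreg, hroot, hinf⟩, hA, hB⟩ := hP
  have hpoly : pencilPoly P = ∏ i, (C (P.1 i i) + X * C (P.2 i i)) := by
    unfold pencilPoly
    rw [Matrix.det_of_isUpperTriangular]
    · simp
    · intro i k hik
      simp [hA i k hik, hB i k hik]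
  refine ⟨fun h0 => hreg ?_, fun hb => hroot _ ?_, fun hb => hinf ?_⟩
  · rw [hpoly]
    obtain ⟨ha, hb⟩ := Prod.mk.inj h0
    exact Finset.prod_eq_zero (Finset.mem_univ j) (by simp [ha, hb])
  · rw [hpoly, IsRoot.def, eval_prod]
    refine Finset.prod_eq_zero (Finset.mem_univ j) ?_
    simp only [eval_add, eval_C, eval_mul, eval_X]
    field_simp
    ring
  · rw [Matrix.det_of_isUpperTriangular fun i k hik => hB i k hik]
    exact Finset.prod_eq_zero (Finset.mem_univ j) hb

/-- An upper triangular matrix over a field with at most one zero diagonal entry has corank at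
most one. -/
theorem Matrix.card_le_rank_add_one_of_upperTriangular {K m : Type*} [Field K] [Fintype m]
    [LinearOrder m] {M : Matrix m m K} (hM : M.BlockTriangular id) (i : m)
    (hdiag : ∀ j, j ≠ i → M j j ≠ 0) : Fintype.card m ≤ M.rank + 1 := by
  let N : Matrix {j // j ≠ i} {j // j ≠ i} K := M.submatrix (↑) (↑)
  have hdet : N.det ≠ 0 := by
    have hN : N.BlockTriangular id := fun j k hjk => hM (show (k : m) < j from hjk)
    rw [Matrix.det_of_isUpperTriangular hN, Finset.prod_ne_zero_iff]
    exact fun j _ => hdiag j j.2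
  have hrank := Matrix.rank_of_isUnit N ((Matrix.isUnit_iff_isUnit_det _).2 hdet.isUnit)
  have hle : N.rank ≤ M.rank := Matrix.rank_submatrix_le M _ _
  have hcard : Fintype.card {j // j ≠ i} = Fintype.card m - 1 := by simp
  omega

/-- A square matrix over a field with zero determinant is rank deficient. -/
theorem Matrix.rank_lt_card_of_det_eq_zero {K m : Type*} [Field K] [Fintype m] [DecidableEq m]
    {M : Matrix m m K} (hM : M.det = 0) : M.rank < Fintype.card m := by
  obtain ⟨v, hv, hMv⟩ := Matrix.exists_mulVec_eq_zero_iff.2 hM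
  have hker : 0 < Module.finrank K (LinearMap.ker M.mulVecLin) :=
    Module.finrank_pos_iff_exists_ne_zero.2 ⟨⟨v, by simpa using hMv⟩, by simpa using hv⟩
  have hsum := LinearMap.finrank_range_add_finrank_ker M.mulVecLin
  rw [Module.finrank_fintype_fun_eq_card] at hsum
  rw [Matrix.rank]
  omega

/-- If an upper triangular pencil with a `(0, 0)` diagonal pair at `i` drops rank at `x₀`, then
some other diagonal pair vanishes at `x₀`. -/
theorem exists_diag_eq_zero_of_rank_lt_iSup {n : ℕ} {A B : Matrix (Fin n) (Fin n) ℂ}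
    (hA : ∀ i j : Fin n, j < i → A i j = 0) (hB : ∀ i j : Fin n, j < i → B i j = 0)
    {i : Fin n} (hAi : A i i = 0) (hBi : B i i = 0) {x₀ : ℂ}
    (hlt : (A + x₀ • B).rank < ⨆ x : ℂ, (A + x • B).rank) :
    ∃ j, j ≠ i ∧ A j j + x₀ * B j j = 0 := by
  have htri : ∀ x : ℂ, (A + x • B).BlockTriangular id := fun x j k hjk => by
    simp [hA j k hjk, hB j k hjk]
  by_contra! hne
  have hge := Matrix.card_le_rank_add_one_of_upperTriangular (htri x₀) i (by simpa using hne)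
  obtain ⟨x, hx⟩ := exists_lt_of_lt_ciSup hlt
  have hdet : (A + x • B).det = 0 := by
    rw [Matrix.det_of_isUpperTriangular (htri x)]
    exact Finset.prod_eq_zero (Finset.mem_univ i) (by simp [hAi, hBi])
  have := Matrix.rank_lt_card_of_det_eq_zero hdet
  omega

/-- if an upper triangular pencil `(A,B)` in the closure of `S_tri(Ω,n)`
has exactly one index `i` with `(A_{ii}, B_{ii}) = (0,0)` (so it is singular), then all
its eigenvalues, in the rank-drop sense valid for singular pencils, belong to `Ω`. -/
theorem singular_one_zero_diag_eigenvalues {n : ℕ} (Ω : Set (OnePoint ℂ))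
    (hclosed : IsClosed Ω) (hne : Ω.Nonempty)
    (A B : Matrix (Fin n) (Fin n) ℂ)
    (hA : ∀ i j : Fin n, j < i → A i j = 0) (hB : ∀ i j : Fin n, j < i → B i j = 0)
    (hmem : (A, B) ∈ closure (Stri Ω n))
    (huniq : ∃! i : Fin n, A i i = 0 ∧ B i i = 0) :
    (∀ x₀ : ℂ, (A + x₀ • B).rank < (⨆ x : ℂ, (A + x • B).rank) → (x₀ : OnePoint ℂ) ∈ Ω) ∧
    ((B + (0 : ℂ) • A).rank < (⨆ x : ℂ, (B + x • A).rank) →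
      (OnePoint.infty : OnePoint ℂ) ∈ Ω) := by
  obtain ⟨i, ⟨hAi, hBi⟩, huniq⟩ := huniq
  have hdiag : ∀ j, j ≠ i → (A j j, B j j) ∈ SOmega1 Ω := fun j hj => by
    refine mem_SOmega1_of_mem_closure hclosed ?_ fun h => hj (huniq j (Prod.mk.inj h))
    exact map_mem_closure
      (f := fun P : Matrix (Fin n) (Fin n) ℂ × Matrix (Fin n) (Fin n) ℂ => (P.1 j j, P.2 j j))
      (by fun_prop) hmem fun P hP => diag_mem_SOmega1_of_mem_Stri hP j
  refine ⟨fun x₀ hlt => ?_, fun hlt => ?_⟩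
  · obtain ⟨j, hj, hzero⟩ := exists_diag_eq_zero_of_rank_lt_iSup hA hB hAi hBi hlt
    obtain ⟨hne0, hfin, -⟩ := hdiag j hj
    have hb : B j j ≠ 0 := fun hb => hne0 (by simpa [hb] using hzero)
    have hx : x₀ = -A j j / B j j := by
      rw [eq_div_iff hb]
      linear_combination hzero
    exact hx ▸ hfin hb
  · obtain ⟨j, hj, hzero⟩ := exists_diag_eq_zero_of_rank_lt_iSup hB hA hBi hAi hlt
    exact (hdiag j hj).2.2 (by simpa using hzero)
end
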